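/- arXiv:1703.06518 — 4 statements merged into one kernel-verified Lean document; each statement's English description precedes it below -/
import Mathlib

section
/- Let P = (1/2)P₁ + (1/2)P₂, where P₁ is uniform on [0,1] and P₂ = δ₁ is the Dirac measure at 1. For n ≥ 2, the set {(2i−1)(2n − 1 − √(n² − n + 1))/(2n(n−1)) : 1 ≤ i ≤ n} is an optimal set of n-means for P, and V_n(P) = (4n² − 4(√(n²−n+1)+1)n + 2√(n²−n+1) + 7) / (12(√(n²−n+1) + 2n − 1)²). -/
open MeasureTheory Set Filter Real
open scoped ENNReal

/-- Distortion error of a finite set of quantizers `γ` for the measure `P`. -/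
noncomputable def distortion (P : Measure ℝ) (γ : Finset ℝ) : ℝ :=
  ∫ x, (⨅ c : γ, (x - (c : ℝ)) ^ 2) ∂P

/-- The `n`-th quantization error of `P`. -/
noncomputable def quantErr (P : Measure ℝ) (n : ℕ) : ℝ :=
  sInf {v : ℝ | ∃ γ : Finset ℝ, γ.Nonempty ∧ γ.card ≤ n ∧ v = distortion P γ}

/-- `γ` is an optimal set of `n`-means for `P`. -/
def IsOptimalSet (P : Measure ℝ) (n : ℕ) (γ : Finset ℝ) : Prop :=
  γ.Nonempty ∧ γ.card ≤ n ∧ distortion P γ = quantErr P n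

/-- Uniform distribution on `[a, b]`. -/
noncomputable def unif (a b : ℝ) : Measure ℝ :=
  (ENNReal.ofReal (b - a))⁻¹ • (volume.restrict (Icc a b))

/-- The uniform discrete measure on `{2/3, 5/6, 1}`. -/
noncomputable def discD : Measure ℝ :=
  (3 : ℝ≥0∞)⁻¹ • (Measure.dirac (2/3) + Measure.dirac (5/6) + Measure.dirac 1)

/-- Mixture `(1/2)P₁ + (1/2)P₂`. -/
noncomputable def mix (P₁ P₂ : Measure ℝ) : Measure ℝ :=
  (2 : ℝ≥0∞)⁻¹ • P₁ + (2 : ℝ≥0∞)⁻¹ • P₂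

theorem iInf_sq_le {γ : Finset ℝ} {c : ℝ} (hc : c ∈ γ) (x : ℝ) :
    (⨅ c : γ, (x - (c : ℝ)) ^ 2) ≤ (x - c) ^ 2 :=
  ciInf_le (f := fun c : γ => (x - (c : ℝ)) ^ 2) (Set.finite_range _).bddBelow ⟨c, hc⟩

theorem exists_mem_iInf_sq_eq {γ : Finset ℝ} (hγ : γ.Nonempty) (x : ℝ) :
    ∃ c ∈ γ, (⨅ c : γ, (x - (c : ℝ)) ^ 2) = (x - c) ^ 2 := by
  have := hγ.to_subtype
  obtain ⟨c, hc⟩ := exists_eq_ciInf_of_finite (f := fun c : γ => (x - (c : ℝ)) ^ 2)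
  exact ⟨c, c.2, hc.symm⟩

theorem continuous_iInf_sq {γ : Finset ℝ} (hγ : γ.Nonempty) :
    Continuous fun x : ℝ => ⨅ c : γ, (x - (c : ℝ)) ^ 2 := by
  have := hγ.to_subtype
  have h : (fun x : ℝ => ⨅ c : γ, (x - (c : ℝ)) ^ 2) =
      fun x => Finset.univ.inf' Finset.univ_nonempty fun c : γ => (x - (c : ℝ)) ^ 2 := by
    funext x
    rw [Finset.inf'_univ_eq_ciInf]
  rw [h]
  exact Continuous.finset_inf'_apply _ fun c _ => by fun_prop

theorem integral_mix_unif_dirac {f : ℝ → ℝ} (hf : Continuous f) :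
    ∫ x, f x ∂(mix (unif 0 1) (Measure.dirac 1)) = ((∫ x in (0 : ℝ)..1, f x) + f 1) / 2 := by
  have hu : unif 0 1 = volume.restrict (Icc 0 1) := by simp [unif]
  have hi : Integrable f (volume.restrict (Icc 0 1)) :=
    hf.continuousOn.integrableOn_compact isCompact_Icc
  have hd : Integrable f (Measure.dirac 1) := integrable_dirac (by simp)
  rw [mix, hu, integral_add_measure (hi.smul_measure (by simp)) (hd.smul_measure (by simp)),
    integral_smul_measure, integral_smul_measure, integral_dirac,
    integral_Icc_eq_integral_Ioc, ← intervalIntegral.integral_of_le zero_le_one]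
  simp
  ring

theorem distortion_mix_unif_dirac {γ : Finset ℝ} (hγ : γ.Nonempty) :
    distortion (mix (unif 0 1) (Measure.dirac 1)) γ =
      ((∫ x in (0 : ℝ)..1, ⨅ c : γ, (x - (c : ℝ)) ^ 2) + ⨅ c : γ, (1 - (c : ℝ)) ^ 2) / 2 :=
  integral_mix_unif_dirac (continuous_iInf_sq hγ)

/-- The concave bump `a² - u²`, cut off at zero. -/
noncomputable def bump (a u : ℝ) : ℝ := max (a ^ 2 - u ^ 2) 0

theorem continuous_bump (a : ℝ) : Continuous (bump a) := by
  unfold bump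
  fun_prop

theorem bump_nonneg (a u : ℝ) : 0 ≤ bump a u := le_max_right _ _

theorem intervalIntegrable_bump (a p q : ℝ) : IntervalIntegrable (bump a) volume p q :=
  (continuous_bump a).intervalIntegrable p q

theorem integral_bump_of_le {a t : ℝ} (ht : 0 ≤ t) (hta : t ≤ a) :
    ∫ u in (0 : ℝ)..t, bump a u = a ^ 2 * t - t ^ 3 / 3 := by
  have h : ∫ u in (0 : ℝ)..t, bump a u = ∫ u in (0 : ℝ)..t, (a ^ 2 - u ^ 2) := by
    refine intervalIntegral.integral_congr fun u hu => ?_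
    rw [uIcc_of_le ht] at hu
    exact max_eq_left (by nlinarith [hu.1, hu.2])
  rw [h, intervalIntegral.integral_sub (by simp) (by simp)]
  simp
  ring

theorem integral_bump_of_ge {a t : ℝ} (ha : 0 ≤ a) (hat : a ≤ t) :
    ∫ u in (0 : ℝ)..t, bump a u = 2 * a ^ 3 / 3 := by
  have h : ∫ u in a..t, bump a u = ∫ u in a..t, (0 : ℝ) := by
    refine intervalIntegral.integral_congr fun u hu => ?_
    rw [uIcc_of_le hat] at hu
    exact max_eq_right (by nlinarith [hu.1])
  rw [← intervalIntegral.integral_add_adjacent_intervals (intervalIntegrable_bump a 0 a)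
    (intervalIntegrable_bump a a t), h, integral_bump_of_le ha le_rfl,
    intervalIntegral.integral_zero]
  ring

theorem integral_bump_nonpos {a t : ℝ} (ht : t ≤ 0) : ∫ u in (0 : ℝ)..t, bump a u ≤ 0 := by
  rw [intervalIntegral.integral_symm]
  exact neg_nonpos.2 (intervalIntegral.integral_nonneg ht fun u _ => bump_nonneg a u)

theorem integral_bump_neg (a t : ℝ) :
    ∫ u in (0 : ℝ)..-t, bump a u = -∫ u in (0 : ℝ)..t, bump a u := by
  have h := intervalIntegral.integral_comp_neg (a := 0) (b := t) (bump a)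
  have he : ∀ u, bump a (-u) = bump a u := fun u => by simp [bump]
  simp only [he, neg_zero] at h
  rw [intervalIntegral.integral_symm, ← h]

theorem integral_bump_le {a : ℝ} (ha : 0 ≤ a) (t : ℝ) :
    ∫ u in (0 : ℝ)..t, bump a u ≤ 2 * a ^ 3 / 3 := by
  rcases le_total t 0 with ht | ht
  · exact (integral_bump_nonpos ht).trans (by positivity)
  rcases le_total t a with hta | hta
  · rw [integral_bump_of_le ht hta]
    nlinarith [mul_nonneg (sq_nonneg (a - t)) (by linarith : 0 ≤ 2 * a + t)]
  · exact (integral_bump_of_ge ha hta).le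

theorem integral_bump_le_sq_add {a d : ℝ} (ha : 0 ≤ a) (hd : 0 ≤ d) (had : a ^ 2 = d ^ 2 + 2 * d)
    (t : ℝ) :
    ∫ u in (0 : ℝ)..t, bump a u ≤ t ^ 2 + (a ^ 2 * d - d ^ 3 / 3 - d ^ 2) := by
  have key : ∀ s, 0 ≤ s → a ^ 2 * s - s ^ 3 / 3 ≤ s ^ 2 + (a ^ 2 * d - d ^ 3 / 3 - d ^ 2) := by
    intro s hs
    rw [had]
    nlinarith [mul_nonneg (sq_nonneg (s - d)) (by linarith : 0 ≤ s + 2 * d + 3)]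
  rcases le_total t 0 with ht | ht
  · refine (integral_bump_nonpos ht).trans ?_
    nlinarith [key 0 le_rfl, sq_nonneg t]
  rcases le_total t a with hta | hta
  · rw [integral_bump_of_le ht hta]
    exact key t ht
  · rw [integral_bump_of_ge ha hta]
    nlinarith [key a ha]

theorem integral_bump_sub (a c : ℝ) :
    ∫ x in (0 : ℝ)..1, bump a (x - c) =
      (∫ u in (0 : ℝ)..1 - c, bump a u) + ∫ u in (0 : ℝ)..c, bump a u := by
  rw [intervalIntegral.integral_comp_sub_right (bump a) c, zero_sub,
    ← intervalIntegral.integral_interval_sub_left (intervalIntegrable_bump a 0 (1 - c))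
      (intervalIntegrable_bump a 0 (-c)), integral_bump_neg, sub_neg_eq_add]

theorem sq_sub_sum_bump_le_iInf {γ : Finset ℝ} (hγ : γ.Nonempty) (a x : ℝ) :
    a ^ 2 - ∑ c ∈ γ, bump a (x - c) ≤ ⨅ c : γ, (x - (c : ℝ)) ^ 2 := by
  obtain ⟨c, hc, h⟩ := exists_mem_iInf_sq_eq hγ x
  rw [h]
  have h₁ : bump a (x - c) ≤ ∑ c ∈ γ, bump a (x - c) :=
    Finset.single_le_sum (f := fun c => bump a (x - c)) (fun c _ => bump_nonneg a (x - c)) hc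
  have h₂ : a ^ 2 - (x - c) ^ 2 ≤ bump a (x - c) := le_max_left _ _
  linarith

theorem le_distortion {γ : Finset ℝ} (hγ : γ.Nonempty) {n : ℕ} (hn : γ.card ≤ n) {a d : ℝ}
    (ha : 0 ≤ a) (hd : 0 ≤ d) (had : a ^ 2 = d ^ 2 + 2 * d) (hsum : (2 * n - 1) * a + d = 1) :
    ((2 * n - 1) * a ^ 3 / 3 + d ^ 3 / 3 + d ^ 2) / 2 ≤
      distortion (mix (unif 0 1) (Measure.dirac 1)) γ := by
  rw [distortion_mix_unif_dirac hγ]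
  obtain ⟨e, he, h1⟩ := exists_mem_iInf_sq_eq hγ 1
  have hbc : ∀ c, Continuous fun x => bump a (x - c) := fun c =>
    (continuous_bump a).comp (by fun_prop)
  have hint : ∫ x in (0 : ℝ)..1, (a ^ 2 - ∑ c ∈ γ, bump a (x - c)) ≤
      ∫ x in (0 : ℝ)..1, ⨅ c : γ, (x - (c : ℝ)) ^ 2 :=
    intervalIntegral.integral_mono zero_le_one
      ((continuous_const.sub (continuous_finsetSum _ fun c _ => hbc c)).intervalIntegrable _ _)
      ((continuous_iInf_sq hγ).intervalIntegrable _ _) fun x => sq_sub_sum_bump_le_iInf hγ a x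
  rw [intervalIntegral.integral_sub (by simp)
    ((continuous_finsetSum _ fun c _ => hbc c).intervalIntegrable _ _),
    intervalIntegral.integral_finsetSum fun c _ => (hbc c).intervalIntegrable _ _,
    ← Finset.add_sum_erase γ _ he] at hint
  have herase : ∑ c ∈ γ.erase e, ∫ x in (0 : ℝ)..1, bump a (x - c) ≤
      (n - 1) * (4 * a ^ 3 / 3) := by
    have hcard : ((γ.erase e).card : ℝ) ≤ n - 1 := by
      have h : (γ.erase e).card + 1 ≤ n := by rwa [Finset.card_erase_add_one he]
      have : ((γ.erase e).card : ℝ) + 1 ≤ n := by exact_mod_cast h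
      linarith
    refine (Finset.sum_le_card_nsmul _ _ (4 * a ^ 3 / 3) fun c _ => ?_).trans ?_
    · rw [integral_bump_sub]
      linarith [integral_bump_le ha (1 - c), integral_bump_le ha c]
    · rw [nsmul_eq_mul]
      gcongr
  have hlast := integral_bump_le_sq_add ha hd had (1 - e)
  have hlast' := integral_bump_le ha e
  rw [integral_bump_sub] at hint
  simp only [intervalIntegral.integral_const, sub_zero, smul_eq_mul, one_mul] at hint
  rw [h1]
  have hd' : d = 1 - (2 * n - 1) * a := by linarith
  have hval : a ^ 2 = (2 * n - 1) * a ^ 3 + a ^ 2 * d := by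
    rw [hd']
    ring
  linarith

theorem integral_sq_sub (p q c : ℝ) :
    ∫ x in p..q, (x - c) ^ 2 = ((q - c) ^ 3 - (p - c) ^ 3) / 3 := by
  rw [intervalIntegral.integral_comp_sub_right (fun x => x ^ 2) c, integral_pow]
  norm_num

theorem integral_iInf_sq_le {γ : Finset ℝ} {c : ℝ} (hc : c ∈ γ) {p q : ℝ} (hpq : p ≤ q) :
    ∫ x in p..q, (⨅ c : γ, (x - (c : ℝ)) ^ 2) ≤ ((q - c) ^ 3 - (p - c) ^ 3) / 3 := by
  rw [← integral_sq_sub]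
  exact intervalIntegral.integral_mono hpq
    ((continuous_iInf_sq ⟨c, hc⟩).intervalIntegrable _ _)
    ((by fun_prop : Continuous fun x : ℝ => (x - c) ^ 2).intervalIntegrable _ _)
    fun x => iInf_sq_le hc x

theorem integral_iInf_sq_le_of_odd_multiples {γ : Finset ℝ} {a : ℝ} (ha : 0 ≤ a) (k : ℕ)
    (hγ : ∀ i < k, (2 * (i : ℝ) + 1) * a ∈ γ) :
    ∫ x in (0 : ℝ)..2 * k * a, (⨅ c : γ, (x - (c : ℝ)) ^ 2) ≤ k * (2 * a ^ 3 / 3) := by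
  induction k with
  | zero => simp
  | succ k ih =>
    have hk := hγ k k.lt_succ_self
    have hc := continuous_iInf_sq ⟨_, hk⟩
    rw [← intervalIntegral.integral_add_adjacent_intervals (b := 2 * k * a)
      (hc.intervalIntegrable _ _) (hc.intervalIntegrable _ _)]
    have h := integral_iInf_sq_le hk (p := 2 * k * a) (q := 2 * (k + 1 : ℕ) * a)
      (by push_cast; nlinarith)
    have hi := ih fun i hi => hγ i (hi.trans k.lt_succ_self)
    push_cast at h ⊢
    ring_nf at h hi ⊢
    linarith

theorem distortion_le {γ : Finset ℝ} {n : ℕ} (hn : 1 ≤ n) {a d : ℝ}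
    (ha : 0 ≤ a) (hd : 0 ≤ d) (hsum : (2 * n - 1) * a + d = 1)
    (hγ : ∀ i < n, (2 * (i : ℝ) + 1) * a ∈ γ) :
    distortion (mix (unif 0 1) (Measure.dirac 1)) γ ≤
      ((2 * n - 1) * a ^ 3 / 3 + d ^ 3 / 3 + d ^ 2) / 2 := by
  obtain ⟨k, rfl⟩ := Nat.exists_eq_add_of_le' hn
  have hk := hγ k k.lt_succ_self
  have hc := continuous_iInf_sq ⟨_, hk⟩
  push_cast at hsum ⊢
  have hd' : (1 : ℝ) - (2 * k + 1) * a = d := by linarith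
  rw [distortion_mix_unif_dirac ⟨_, hk⟩, ← intervalIntegral.integral_add_adjacent_intervals
    (b := 2 * k * a) (hc.intervalIntegrable _ _) (hc.intervalIntegrable _ _)]
  have hfirst := integral_iInf_sq_le_of_odd_multiples ha k
    fun i hi => hγ i (hi.trans k.lt_succ_self)
  have hlast := integral_iInf_sq_le hk (p := 2 * k * a) (q := 1) (by linarith)
  have hone := iInf_sq_le hk 1
  rw [hd'] at hlast hone
  have hp : (2 * k * a - (2 * k + 1) * a) ^ 3 = -a ^ 3 := by ring
  rw [hp] at hlast
  linarith

theorem quantErr_eq_distortion {P : Measure ℝ} {n : ℕ} {γ : Finset ℝ} (hγ : γ.Nonempty)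
    (hcard : γ.card ≤ n)
    (hmin : ∀ γ' : Finset ℝ, γ'.Nonempty → γ'.card ≤ n → distortion P γ ≤ distortion P γ') :
    quantErr P n = distortion P γ := by
  refine IsLeast.csInf_eq ⟨⟨γ, hγ, hcard, rfl⟩, ?_⟩
  rintro v ⟨γ', h₁, h₂, rfl⟩
  exact hmin γ' h₁ h₂

theorem stmt7 (P : Measure ℝ) (hP : P = mix (unif 0 1) (Measure.dirac 1))
    (n : ℕ) (hn : 2 ≤ n) :
    IsOptimalSet P n
      (Finset.image
        (fun i : ℕ =>
          (2 * (i : ℝ) + 1) * (2 * n - 1 - Real.sqrt ((n : ℝ) ^ 2 - n + 1)) /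
            (2 * n * ((n : ℝ) - 1)))
        (Finset.range n)) ∧
    quantErr P n =
      (4 * (n : ℝ) ^ 2 - 4 * (Real.sqrt ((n : ℝ) ^ 2 - n + 1) + 1) * n +
          2 * Real.sqrt ((n : ℝ) ^ 2 - n + 1) + 7) /
        (12 * (Real.sqrt ((n : ℝ) ^ 2 - n + 1) + 2 * n - 1) ^ 2) := by
  subst hP
  have hn' : (2 : ℝ) ≤ n := by exact_mod_cast hn
  set s := Real.sqrt ((n : ℝ) ^ 2 - n + 1)
  have hs2 : s ^ 2 = (n : ℝ) ^ 2 - n + 1 := Real.sq_sqrt (by nlinarith)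
  have hs0 : 0 ≤ s := Real.sqrt_nonneg _
  have hpos : 0 < s + 2 * n - 1 := by linarith
  set γ := Finset.image
    (fun i : ℕ => (2 * (i : ℝ) + 1) * (2 * n - 1 - s) / (2 * n * ((n : ℝ) - 1))) (Finset.range n)
  obtain ⟨a, ha⟩ : ∃ a, a = 3 / (2 * (s + 2 * n - 1)) := ⟨_, rfl⟩
  obtain ⟨d, hd⟩ : ∃ d, d = (2 * s - (2 * n - 1)) / (2 * (s + 2 * n - 1)) := ⟨_, rfl⟩
  have ha0 : 0 ≤ a := by rw [ha]; positivity
  have hd0 : 0 ≤ d := by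
    rw [hd]
    exact div_nonneg (by nlinarith) (by linarith)
  have hsum : (2 * n - 1) * a + d = 1 := by
    rw [ha, hd]
    field_simp
    ring
  have had : a ^ 2 = d ^ 2 + 2 * d := by
    rw [ha, hd]
    field_simp
    linear_combination (-12) * hs2
  have hform : (2 * n - 1 - s) / (2 * n * ((n : ℝ) - 1)) = a := by
    rw [ha, div_eq_div_iff (by nlinarith) (by linarith)]
    linear_combination (-2) * hs2
  have hmem : ∀ i < n, (2 * (i : ℝ) + 1) * a ∈ γ := fun i hi =>
    Finset.mem_image.2 ⟨i, Finset.mem_range.2 hi, by rw [mul_div_assoc, hform]⟩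
  have hne : γ.Nonempty := ⟨_, hmem 0 (by lia)⟩
  have hcard : γ.card ≤ n := Finset.card_image_le.trans (Finset.card_range n).le
  have hupper := distortion_le (by lia) ha0 hd0 hsum hmem
  have hlower := le_distortion hne hcard ha0 hd0 had hsum
  have hquant := quantErr_eq_distortion hne hcard fun γ' h₁ h₂ =>
    hupper.trans (le_distortion h₁ h₂ ha0 hd0 had hsum)
  refine ⟨⟨hne, hcard, hquant.symm⟩, ?_⟩
  rw [hquant, le_antisymm hupper hlower, ha, hd]
  field_simp
  linear_combination (384 * s + 48 - 96 * n) * hs2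
end

section
/- Let P₁ be the self-similar measure satisfying P₁ = (1/2)P₁∘S₁⁻¹ + (1/2)P₁∘S₂⁻¹ with S₁(x)=x/3, S₂(x)=x/3+1/3, P₂ the uniform discrete measure on {2/3, 5/6, 1}, and P = (1/2)P₁ + (1/2)P₂. Then {1/4, 5/6} is an optimal set of two-means for P, with quantization error V₂(P) = 43/1728. -/
open MeasureTheory Set Filter Real
open scoped ENNReal

open Topology

lemma iInf_sq_sub_pair (a b x : ℝ) :
    (⨅ c : ({a, b} : Finset ℝ), (x - (c : ℝ)) ^ 2) = min ((x - a) ^ 2) ((x - b) ^ 2) := by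
  have : Nonempty ({a, b} : Finset ℝ) := ⟨⟨a, by simp⟩⟩
  apply le_antisymm
  · have hbdd : BddBelow (Set.range fun c : ({a, b} : Finset ℝ) => (x - (c : ℝ)) ^ 2) :=
      (Set.finite_range _).bddBelow
    exact le_min (ciInf_le hbdd ⟨a, by simp⟩) (ciInf_le hbdd ⟨b, by simp⟩)
  · refine le_ciInf fun ⟨c, hc⟩ => ?_
    rcases Finset.mem_insert.1 hc with rfl | hc
    · exact min_le_left _ _
    · obtain rfl := Finset.mem_singleton.1 hc
      exact min_le_right _ _

/-- Every nonempty set of at most two points is an ordered, possibly degenerate, pair. -/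
lemma exists_le_eq_pair {γ : Finset ℝ} (hne : γ.Nonempty) (hcard : γ.card ≤ 2) :
    ∃ a b : ℝ, a ≤ b ∧ γ = {a, b} := by
  have hpos := hne.card_pos
  obtain h | h : γ.card = 1 ∨ γ.card = 2 := by omega
  · obtain ⟨a, rfl⟩ := Finset.card_eq_one.1 h
    exact ⟨a, a, le_rfl, by simp⟩
  · obtain ⟨a, b, -, rfl⟩ := Finset.card_eq_two.1 h
    rcases le_total a b with hab | hab
    · exact ⟨a, b, hab, rfl⟩
    · exact ⟨b, a, hab, Finset.pair_comm a b⟩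

lemma min_sq_sub_eq {a b : ℝ} (hab : a ≤ b) (x : ℝ) :
    min ((x - a) ^ 2) ((x - b) ^ 2) = (x - a) ^ 2 - (b - a) * max (2 * x - (a + b)) 0 := by
  rcases le_total (2 * x - (a + b)) 0 with h | h
  · rw [max_eq_right h, min_eq_left (by nlinarith)]
    ring
  · rw [max_eq_left h, min_eq_right (by nlinarith)]
    ring

section SelfSimilar

variable {μ : Measure ℝ} [IsProbabilityMeasure μ]

/-- A self-similar measure for the contractions `x / 3` and `x / 3 + 1 / 3` lives on `[0, 1/2]`. -/
lemma ae_mem_Icc_of_selfSimilar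
    (hμ : μ = (2 : ℝ≥0∞)⁻¹ • μ.map (fun x => x / 3) +
      (2 : ℝ≥0∞)⁻¹ • μ.map (fun x => x / 3 + 1/3)) :
    ∀ᵐ x ∂μ, x ∈ Icc (0 : ℝ) (1/2) := by
  have hmeas (r : ℝ) : MeasurableSet {x : ℝ | r < |x - 1/4|} :=
    measurableSet_lt measurable_const (by fun_prop)
  have hstep (δ : ℝ) : μ {x | 1/4 + δ < |x - 1/4|} ≤ μ {x | 1/4 + 3 * δ < |x - 1/4|} := by
    conv_lhs => rw [hμ]
    rw [Measure.add_apply, Measure.smul_apply, Measure.smul_apply,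
      Measure.map_apply (by fun_prop) (hmeas _), Measure.map_apply (by fun_prop) (hmeas _),
      smul_eq_mul, smul_eq_mul, ← mul_add]
    have h₁ : (fun x : ℝ => x / 3) ⁻¹' {x | 1/4 + δ < |x - 1/4|} ⊆
        {x | 1/4 + 3 * δ < |x - 1/4|} := by
      intro x hx
      simp only [mem_preimage, mem_ofPred_eq, lt_abs] at hx ⊢
      rcases hx with hx | hx
      · left; linarith
      · right; linarith
    have h₂ : (fun x : ℝ => x / 3 + 1/3) ⁻¹' {x | 1/4 + δ < |x - 1/4|} ⊆
        {x | 1/4 + 3 * δ < |x - 1/4|} := by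
      intro x hx
      simp only [mem_preimage, mem_ofPred_eq, lt_abs] at hx ⊢
      rcases hx with hx | hx
      · left; linarith
      · right; linarith
    calc _ ≤ (2 : ℝ≥0∞)⁻¹ * (μ {x | 1/4 + 3 * δ < |x - 1/4|} +
          μ {x | 1/4 + 3 * δ < |x - 1/4|}) := by gcongr
      _ = _ := by
        rw [← two_mul, ← mul_assoc, ENNReal.inv_mul_cancel (by norm_num) (by norm_num), one_mul]
  have hiter (δ : ℝ) (n : ℕ) :
      μ {x | 1/4 + δ < |x - 1/4|} ≤ μ {x | 1/4 + 3 ^ n * δ < |x - 1/4|} := by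
    induction n with
    | zero => simp
    | succ n ih =>
      refine ih.trans ((hstep _).trans_eq ?_)
      rw [pow_succ', mul_assoc]
  have hnull (δ : ℝ) (hδ : 0 < δ) : μ {x | 1/4 + δ < |x - 1/4|} = 0 := by
    have hlim : Tendsto (fun n : ℕ => μ {x | 1/4 + 3 ^ n * δ < |x - 1/4|}) atTop
        (𝓝 (μ (⋂ n : ℕ, {x | 1/4 + 3 ^ n * δ < |x - 1/4|}))) := by
      refine tendsto_measure_iInter_atTop (fun n => (hmeas _).nullMeasurableSet) ?_
        ⟨0, measure_ne_top _ _⟩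
      intro m n hmn x hx
      have hpow : (3 : ℝ) ^ m * δ ≤ 3 ^ n * δ := by gcongr; norm_num
      exact lt_of_le_of_lt (by linarith) (show 1/4 + 3 ^ n * δ < |x - 1/4| from hx)
    have hempty : (⋂ n : ℕ, {x : ℝ | 1/4 + 3 ^ n * δ < |x - 1/4|}) = ∅ := by
      refine eq_empty_of_forall_notMem fun x hx => ?_
      obtain ⟨n, hn⟩ := pow_unbounded_of_one_lt (|x - 1/4| / δ) (by norm_num : (1 : ℝ) < 3)
      have hlt : 1/4 + 3 ^ n * δ < |x - 1/4| := mem_iInter.1 hx n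
      rw [div_lt_iff₀ hδ] at hn
      linarith
    rw [hempty, measure_empty] at hlim
    exact le_antisymm (ge_of_tendsto' hlim (hiter δ)) zero_le
  have hae (n : ℕ) : ∀ᵐ x ∂μ, |x - 1/4| ≤ 1/4 + 1 / ((n : ℝ) + 1) := by
    rw [ae_iff]
    simpa only [not_le] using hnull _ (Nat.one_div_pos_of_nat (α := ℝ) (n := n))
  filter_upwards [ae_all_iff.2 hae] with x hx
  have hle : |x - 1/4| ≤ 1/4 := by
    refine le_of_forall_pos_le_add fun ε hε => ?_
    obtain ⟨n, hn⟩ := exists_nat_one_div_lt hε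
    linarith [hx n]
  obtain ⟨h₁, h₂⟩ := abs_le.1 hle
  exact ⟨by linarith, by linarith⟩

lemma integrable_of_ae_mem_Icc {a b : ℝ} (hμ : ∀ᵐ x ∂μ, x ∈ Icc a b) {f : ℝ → ℝ}
    (hf : Continuous f) : Integrable f μ := by
  have h : IntegrableOn f (Icc a b) μ := hf.continuousOn.integrableOn_compact isCompact_Icc
  rwa [IntegrableOn, Measure.restrict_eq_self_of_ae_mem hμ] at h

lemma integral_eq_of_selfSimilar
    (hμ : μ = (2 : ℝ≥0∞)⁻¹ • μ.map (fun x => x / 3) +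
      (2 : ℝ≥0∞)⁻¹ • μ.map (fun x => x / 3 + 1/3)) {f : ℝ → ℝ} (hf : Continuous f) :
    ∫ x, f x ∂μ = (∫ x, f (x / 3) ∂μ) / 2 + (∫ x, f (x / 3 + 1/3) ∂μ) / 2 := by
  have hint {g : ℝ → ℝ} (hg : Continuous g) : Integrable g μ :=
    integrable_of_ae_mem_Icc (ae_mem_Icc_of_selfSimilar hμ) hg
  have hmap {g : ℝ → ℝ} (hg : Continuous g) : Integrable f (μ.map g) :=
    (integrable_map_measure hf.aestronglyMeasurable hg.aemeasurable).2 (hint (hf.comp hg))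
  have h2 : (2 : ℝ≥0∞)⁻¹ ≠ ∞ := by norm_num
  conv_lhs => rw [hμ]
  rw [integral_add_measure ((hmap (by fun_prop)).smul_measure h2)
    ((hmap (by fun_prop)).smul_measure h2), integral_smul_measure, integral_smul_measure,
    integral_map (by fun_prop) hf.aestronglyMeasurable,
    integral_map (by fun_prop) hf.aestronglyMeasurable]
  simp only [ENNReal.toReal_inv, ENNReal.toReal_ofNat, smul_eq_mul]
  ring

lemma integral_id_of_selfSimilar
    (hμ : μ = (2 : ℝ≥0∞)⁻¹ • μ.map (fun x => x / 3) +
      (2 : ℝ≥0∞)⁻¹ • μ.map (fun x => x / 3 + 1/3)) :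
    ∫ x, x ∂μ = 1/4 := by
  have hint {g : ℝ → ℝ} (hg : Continuous g) : Integrable g μ :=
    integrable_of_ae_mem_Icc (ae_mem_Icc_of_selfSimilar hμ) hg
  have h := integral_eq_of_selfSimilar hμ continuous_id
  simp only [id] at h
  rw [integral_add (hint (by fun_prop)) (hint (by fun_prop)), integral_div, integral_const,
    probReal_univ, one_smul] at h
  linarith

lemma integral_sq_of_selfSimilar
    (hμ : μ = (2 : ℝ≥0∞)⁻¹ • μ.map (fun x => x / 3) +
      (2 : ℝ≥0∞)⁻¹ • μ.map (fun x => x / 3 + 1/3)) :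
    ∫ x, x ^ 2 ∂μ = 3/32 := by
  have hint {g : ℝ → ℝ} (hg : Continuous g) : Integrable g μ :=
    integrable_of_ae_mem_Icc (ae_mem_Icc_of_selfSimilar hμ) hg
  have h := integral_eq_of_selfSimilar hμ (continuous_pow 2)
  have h₁ : ∫ x, (x / 3) ^ 2 ∂μ = (∫ x, x ^ 2 ∂μ) / 9 := by
    rw [← integral_div]
    congr 1 with x
    ring
  have h₂ : ∫ x, (x / 3 + 1/3) ^ 2 ∂μ = (∫ x, x ^ 2 ∂μ) / 9 + 2/9 * (∫ x, x ∂μ) + 1/9 := by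
    have : ∫ x, (x / 3 + 1/3) ^ 2 ∂μ = ∫ x, (x ^ 2 / 9 + 2/9 * x + 1/9) ∂μ := by
      congr 1 with x
      ring
    rw [this, integral_add (hint (by fun_prop)) (hint (by fun_prop)),
      integral_add (hint (by fun_prop)) (hint (by fun_prop)), integral_div, integral_const_mul,
      integral_const, probReal_univ, one_smul]
  rw [h₁, h₂, integral_id_of_selfSimilar hμ] at h
  linarith

lemma integral_sq_sub_of_selfSimilar
    (hμ : μ = (2 : ℝ≥0∞)⁻¹ • μ.map (fun x => x / 3) +
      (2 : ℝ≥0∞)⁻¹ • μ.map (fun x => x / 3 + 1/3)) (a : ℝ) :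
    ∫ x, (x - a) ^ 2 ∂μ = 1/32 + (a - 1/4) ^ 2 := by
  have hint {g : ℝ → ℝ} (hg : Continuous g) : Integrable g μ :=
    integrable_of_ae_mem_Icc (ae_mem_Icc_of_selfSimilar hμ) hg
  have : ∫ x, (x - a) ^ 2 ∂μ = ∫ x, (x ^ 2 - 2 * a * x + a ^ 2) ∂μ := by
    congr 1 with x
    ring
  rw [this, integral_add (hint (by fun_prop)) (hint (by fun_prop)),
    integral_sub (hint (by fun_prop)) (hint (by fun_prop)), integral_const_mul,
    integral_const, probReal_univ, one_smul, integral_id_of_selfSimilar hμ,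
    integral_sq_of_selfSimilar hμ]
  ring

/-- The mean of a monotone function is at most its average over the right end points of the four
second-level cells of the self-similar set. -/
lemma integral_le_of_selfSimilar_of_monotone
    (hμ : μ = (2 : ℝ≥0∞)⁻¹ • μ.map (fun x => x / 3) +
      (2 : ℝ≥0∞)⁻¹ • μ.map (fun x => x / 3 + 1/3)) {f : ℝ → ℝ} (hf : Continuous f)
    (hmono : Monotone f) :
    ∫ x, f x ∂μ ≤ (f (1/18) + f (1/6) + f (7/18) + f (1/2)) / 4 := by
  have hsupp := ae_mem_Icc_of_selfSimilar hμ
  have hle {g : ℝ → ℝ} (hg : Continuous g) {c : ℝ} (hc : ∀ x ≤ (1/2 : ℝ), g x ≤ c) :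
      ∫ x, f (g x) ∂μ ≤ f c := by
    calc ∫ x, f (g x) ∂μ ≤ ∫ _, f c ∂μ := by
          refine integral_mono_ae (integrable_of_ae_mem_Icc hsupp (hf.comp hg))
            (integrable_const _) ?_
          filter_upwards [hsupp] with x hx
          exact hmono (hc x hx.2)
      _ = f c := by simp
  have h₁ := integral_eq_of_selfSimilar hμ (f := fun x => f (x / 3)) (by fun_prop)
  have h₂ := integral_eq_of_selfSimilar hμ (f := fun x => f (x / 3 + 1/3)) (by fun_prop)
  have h₃ := hle (g := fun x => x / 3 / 3) (c := 1/18) (by fun_prop) fun x hx => by linarith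
  have h₄ := hle (g := fun x => (x / 3 + 1/3) / 3) (c := 1/6) (by fun_prop)
    fun x hx => by linarith
  have h₅ := hle (g := fun x => x / 3 / 3 + 1/3) (c := 7/18) (by fun_prop)
    fun x hx => by linarith
  have h₆ := hle (g := fun x => (x / 3 + 1/3) / 3 + 1/3) (c := 1/2) (by fun_prop)
    fun x hx => by linarith
  rw [integral_eq_of_selfSimilar hμ hf, h₁, h₂]
  linarith

/-- The part of `μ` on the right of the midpoint `s / 2` gains little over the quantizer `a`,
compared with the displacement of `a` and `b` from the means `1/4` and `5/6`. -/
lemma mul_integral_max_le_of_selfSimilar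
    (hμ : μ = (2 : ℝ≥0∞)⁻¹ • μ.map (fun x => x / 3) +
      (2 : ℝ≥0∞)⁻¹ • μ.map (fun x => x / 3 + 1/3)) {a b : ℝ} (hab : a ≤ b) :
    (b - a) * ∫ x, max (2 * x - (a + b)) 0 ∂μ ≤ (a - 1/4) ^ 2 + (b - 5/6) ^ 2 := by
  have hsupp := ae_mem_Icc_of_selfSimilar hμ
  have hint {g : ℝ → ℝ} (hg : Continuous g) : Integrable g μ := integrable_of_ae_mem_Icc hsupp hg
  obtain ⟨s, rfl⟩ : ∃ s, b = s - a := ⟨a + b, by ring⟩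
  simp only [add_sub_cancel]
  rcases le_total s 0 with hs | hs
  · have hI : ∫ x, max (2 * x - s) 0 ∂μ = 1/2 - s := by
      have : ∫ x, max (2 * x - s) 0 ∂μ = ∫ x, (2 * x - s) ∂μ := by
        refine integral_congr_ae ?_
        filter_upwards [hsupp] with x hx
        exact max_eq_left (by linarith [hx.1])
      rw [this, integral_sub (hint (by fun_prop)) (hint (by fun_prop)), integral_const_mul,
        integral_id_of_selfSimilar hμ, integral_const, probReal_univ, one_smul]
      norm_num
    rw [hI]
    nlinarith [sq_nonneg (s - a - a - 7/12 - (1/2 - s))]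
  · have hI := integral_le_of_selfSimilar_of_monotone hμ (f := fun x => max (2 * x - s) 0)
      (by fun_prop) (fun x y hxy => max_le_max (by linarith) le_rfl)
    refine (mul_le_mul_of_nonneg_left hI (sub_nonneg.2 hab)).trans ?_
    rcases le_total (1 : ℝ) s with h | h
    · rw [max_eq_right (by linarith), max_eq_right (by linarith), max_eq_right (by linarith),
        max_eq_right (by linarith)]
      nlinarith [sq_nonneg (a - 1/4), sq_nonneg (s - a - 5/6)]
    rcases le_total (7/9 : ℝ) s with h₁ | h₁
    · rw [max_eq_right (by linarith), max_eq_right (by linarith), max_eq_right (by linarith),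
        max_eq_left (by linarith)]
      nlinarith [sq_nonneg (s - a - a - 7/12 - (1 - s) / 4), sq_nonneg (1 - s - 1/15)]
    rcases le_total (1/3 : ℝ) s with h₂ | h₂
    · rw [max_eq_right (by linarith), max_eq_right (by linarith), max_eq_left (by linarith),
        max_eq_left (by linarith)]
      nlinarith [sq_nonneg (s - a - a - 7/12 - (16/9 - 2 * s) / 4), sq_nonneg (1 - s - 13/54)]
    rcases le_total (1/9 : ℝ) s with h₃ | h₃
    · rw [max_eq_right (by linarith), max_eq_left (by linarith), max_eq_left (by linarith),
        max_eq_left (by linarith)]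
      nlinarith [sq_nonneg (s - a - a - 7/12 - (19/9 - 3 * s) / 4), sq_nonneg (1 - s - 3/7)]
    · rw [max_eq_left (by linarith), max_eq_left (by linarith), max_eq_left (by linarith),
        max_eq_left (by linarith)]
      nlinarith [sq_nonneg (s - a - a - 7/12 - (20/9 - 4 * s) / 4)]

lemma integral_min_sq_sub_of_selfSimilar
    (hμ : μ = (2 : ℝ≥0∞)⁻¹ • μ.map (fun x => x / 3) +
      (2 : ℝ≥0∞)⁻¹ • μ.map (fun x => x / 3 + 1/3)) {a b : ℝ} (hab : a ≤ b) :
    ∫ x, min ((x - a) ^ 2) ((x - b) ^ 2) ∂μ =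
      1/32 + (a - 1/4) ^ 2 - (b - a) * ∫ x, max (2 * x - (a + b)) 0 ∂μ := by
  have hint {g : ℝ → ℝ} (hg : Continuous g) : Integrable g μ :=
    integrable_of_ae_mem_Icc (ae_mem_Icc_of_selfSimilar hμ) hg
  simp only [min_sq_sub_eq hab]
  rw [integral_sub (hint (by fun_prop)) (hint (by fun_prop)), integral_const_mul,
    integral_sq_sub_of_selfSimilar hμ]

lemma integral_max_eq_zero_of_selfSimilar
    (hμ : μ = (2 : ℝ≥0∞)⁻¹ • μ.map (fun x => x / 3) +
      (2 : ℝ≥0∞)⁻¹ • μ.map (fun x => x / 3 + 1/3)) {s : ℝ} (hs : 1 ≤ s) :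
    ∫ x, max (2 * x - s) 0 ∂μ = 0 := by
  refine integral_eq_zero_of_ae ?_
  filter_upwards [ae_mem_Icc_of_selfSimilar hμ] with x hx
  exact max_eq_right (by linarith [hx.2])

lemma distortion_mix_discD_pair
    (hμ : μ = (2 : ℝ≥0∞)⁻¹ • μ.map (fun x => x / 3) +
      (2 : ℝ≥0∞)⁻¹ • μ.map (fun x => x / 3 + 1/3)) (a b : ℝ) :
    distortion (mix μ discD) {a, b} = (∫ x, min ((x - a) ^ 2) ((x - b) ^ 2) ∂μ) / 2 +
      (min ((2/3 - a) ^ 2) ((2/3 - b) ^ 2) + min ((5/6 - a) ^ 2) ((5/6 - b) ^ 2) +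
        min ((1 - a) ^ 2) ((1 - b) ^ 2)) / 6 := by
  unfold distortion mix discD
  simp only [iInf_sq_sub_pair]
  set f : ℝ → ℝ := fun x => min ((x - a) ^ 2) ((x - b) ^ 2) with hf
  have h2 : (2 : ℝ≥0∞)⁻¹ ≠ ∞ := by norm_num
  have h3 : (3 : ℝ≥0∞)⁻¹ ≠ ∞ := by norm_num
  have hint : Integrable f μ :=
    integrable_of_ae_mem_Icc (ae_mem_Icc_of_selfSimilar hμ) (by fun_prop)
  have hdirac (c : ℝ) : Integrable f (Measure.dirac c) := integrable_dirac (by simp)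
  rw [integral_add_measure (hint.smul_measure h2)
      (((((hdirac _).add_measure (hdirac _)).add_measure (hdirac _)).smul_measure h3).smul_measure
        h2),
    integral_smul_measure, integral_smul_measure, integral_smul_measure,
    integral_add_measure ((hdirac _).add_measure (hdirac _)) (hdirac _),
    integral_add_measure (hdirac _) (hdirac _), integral_dirac, integral_dirac, integral_dirac]
  simp only [ENNReal.toReal_inv, ENNReal.toReal_ofNat, smul_eq_mul, hf]
  ring

lemma le_distortion_mix_discD_pair
    (hμ : μ = (2 : ℝ≥0∞)⁻¹ • μ.map (fun x => x / 3) +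
      (2 : ℝ≥0∞)⁻¹ • μ.map (fun x => x / 3 + 1/3)) {a b : ℝ} (hab : a ≤ b) :
    43/1728 ≤ distortion (mix μ discD) {a, b} := by
  rw [distortion_mix_discD_pair hμ, integral_min_sq_sub_of_selfSimilar hμ hab]
  rcases le_total (4/3) (a + b) with hs | hs
  · rw [integral_max_eq_zero_of_selfSimilar hμ (by linarith),
      min_eq_left (by nlinarith : (2/3 - a) ^ 2 ≤ (2/3 - b) ^ 2)]
    have h₁ : 0 ≤ min ((5/6 - a) ^ 2) ((5/6 - b) ^ 2) := le_min (sq_nonneg _) (sq_nonneg _)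
    have h₂ : 0 ≤ min ((1 - a) ^ 2) ((1 - b) ^ 2) := le_min (sq_nonneg _) (sq_nonneg _)
    nlinarith [sq_nonneg (a - 17/48)]
  · rw [min_eq_right (by nlinarith : (2/3 - b) ^ 2 ≤ (2/3 - a) ^ 2),
      min_eq_right (by nlinarith : (5/6 - b) ^ 2 ≤ (5/6 - a) ^ 2),
      min_eq_right (by nlinarith : (1 - b) ^ 2 ≤ (1 - a) ^ 2)]
    linarith [mul_integral_max_le_of_selfSimilar hμ hab]

lemma distortion_mix_discD_means
    (hμ : μ = (2 : ℝ≥0∞)⁻¹ • μ.map (fun x => x / 3) +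
      (2 : ℝ≥0∞)⁻¹ • μ.map (fun x => x / 3 + 1/3)) :
    distortion (mix μ discD) {1/4, 5/6} = 43/1728 := by
  rw [distortion_mix_discD_pair hμ, integral_min_sq_sub_of_selfSimilar hμ (by norm_num),
    integral_max_eq_zero_of_selfSimilar hμ (by norm_num)]
  norm_num

end SelfSimilar

theorem stmt11 (P₁ : Measure ℝ) [IsProbabilityMeasure P₁]
    (hP₁ : P₁ = (2 : ℝ≥0∞)⁻¹ • P₁.map (fun x => x / 3) +
      (2 : ℝ≥0∞)⁻¹ • P₁.map (fun x => x / 3 + 1/3))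
    (P : Measure ℝ) (hP : P = mix P₁ discD) :
    IsOptimalSet P 2 ({1/4, 5/6} : Finset ℝ) ∧ quantErr P 2 = 43/1728 := by
  subst hP
  have hcard : ({1/4, 5/6} : Finset ℝ).card ≤ 2 := Finset.card_le_two
  have hV : quantErr (mix P₁ discD) 2 = 43/1728 := by
    refine IsLeast.csInf_eq ⟨?_, ?_⟩
    · exact ⟨{1/4, 5/6}, by simp, hcard, (distortion_mix_discD_means hP₁).symm⟩
    · rintro v ⟨γ, hne, hγ, rfl⟩
      obtain ⟨a, b, hab, rfl⟩ := exists_le_eq_pair hne hγ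
      exact le_distortion_mix_discD_pair hP₁ hab
  exact ⟨⟨by simp, hcard, (distortion_mix_discD_means hP₁).trans hV.symm⟩, hV⟩
end

section
/- Let P₁ be the self-similar measure satisfying P₁ = (1/2)P₁∘S₁⁻¹ + (1/2)P₁∘S₂⁻¹ with S₁(x)=x/3, S₂(x)=x/3+1/3, P₂ the uniform discrete measure on D = {2/3, 5/6, 1}, and P = (1/2)P₁ + (1/2)P₂. For every n ≥ 5, if α_{n−3}(P₁) is an optimal set of (n−3)-means for P₁, then α_{n−3}(P₁) ∪ D is an optimal set of n-means for P, and V_n(P) = (1/2)V_{n−3}(P₁). -/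
open MeasureTheory Set Filter Real
open scoped ENNReal

/-- The distortion integrand: squared distance from `x` to the nearest point of `β`. -/
noncomputable def nearestSq (β : Finset ℝ) (x : ℝ) : ℝ := ⨅ c : β, (x - (c : ℝ)) ^ 2

lemma distortion_eq (P : Measure ℝ) (β : Finset ℝ) : distortion P β = ∫ x, nearestSq β x ∂P := rfl

lemma nearestSq_nonneg (β : Finset ℝ) (x : ℝ) : 0 ≤ nearestSq β x :=
  Real.iInf_nonneg fun _ => sq_nonneg _

lemma nearestSq_le {β : Finset ℝ} {c : ℝ} (hc : c ∈ β) (x : ℝ) : nearestSq β x ≤ (x - c) ^ 2 :=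
  ciInf_le (f := fun c : β => (x - (c : ℝ)) ^ 2) (Set.finite_range _).bddBelow ⟨c, hc⟩

lemma le_nearestSq {β : Finset ℝ} (hβ : β.Nonempty) {x r : ℝ} (h : ∀ c ∈ β, r ≤ (x - c) ^ 2) :
    r ≤ nearestSq β x := by
  have : Nonempty β := hβ.to_subtype
  exact le_ciInf fun c => h c c.2

lemma exists_nearestSq_eq {β : Finset ℝ} (hβ : β.Nonempty) (x : ℝ) :
    ∃ c ∈ β, nearestSq β x = (x - c) ^ 2 := by
  have : Nonempty β := hβ.to_subtype
  obtain ⟨c, hc⟩ := exists_eq_ciInf_of_finite (f := fun c : β => (x - (c : ℝ)) ^ 2)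
  exact ⟨c, c.2, hc.symm⟩

lemma nearestSq_eq_zero {β : Finset ℝ} {x : ℝ} (hx : x ∈ β) : nearestSq β x = 0 :=
  le_antisymm (by simpa using nearestSq_le hx x) (nearestSq_nonneg β x)

lemma continuous_nearestSq {β : Finset ℝ} (hβ : β.Nonempty) : Continuous (nearestSq β) := by
  have : Nonempty β := hβ.to_subtype
  have h : nearestSq β =
      fun x => Finset.univ.inf' Finset.univ_nonempty (fun c : β => (x - (c : ℝ)) ^ 2) := by
    funext x
    exact (Finset.inf'_univ_eq_ciInf _).symm
  rw [h]
  exact Continuous.finset_inf'_apply _ fun c _ => by fun_prop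

lemma quantErr_le {P : Measure ℝ} {n : ℕ} {β : Finset ℝ} (hβ : β.Nonempty) (hc : β.card ≤ n) :
    quantErr P n ≤ distortion P β := by
  refine csInf_le ⟨0, ?_⟩ ⟨β, hβ, hc, rfl⟩
  rintro v ⟨δ, -, -, rfl⟩
  exact integral_nonneg fun x => nearestSq_nonneg δ x

/-- The invariance equation of the self-similar measure for `x ↦ x / 3` and `x ↦ x / 3 + 1 / 3`. -/
def IsSelfSimilar (μ : Measure ℝ) : Prop :=
  μ = (2 : ℝ≥0∞)⁻¹ • μ.map (fun x => x / 3) + (2 : ℝ≥0∞)⁻¹ • μ.map (fun x => x / 3 + 1/3)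

/-- The transfer operator dual to the invariance equation. -/
noncomputable def transfer (f : ℝ → ℝ) (x : ℝ) : ℝ := (f (x / 3) + f (x / 3 + 1/3)) / 2

lemma continuous_transfer {f : ℝ → ℝ} (hf : Continuous f) : Continuous (transfer f) := by
  unfold transfer
  fun_prop

namespace IsSelfSimilar

variable {μ : Measure ℝ}

lemma measure_outside_le (h : IsSelfSimilar μ) (t : ℝ) :
    μ (Icc (-t) (1/2 + t))ᶜ ≤ μ (Icc (-(3 * t)) (1/2 + 3 * t))ᶜ := by
  have hm : MeasurableSet (Icc (-t) (1/2 + t))ᶜ := measurableSet_Icc.compl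
  have h1 : (fun x : ℝ => x / 3) ⁻¹' (Icc (-t) (1/2 + t))ᶜ ⊆ (Icc (-(3 * t)) (1/2 + 3 * t))ᶜ := by
    intro x hx hx'
    refine hx ⟨?_, ?_⟩ <;> dsimp only <;> linarith [hx'.1, hx'.2]
  have h2 : (fun x : ℝ => x / 3 + 1/3) ⁻¹' (Icc (-t) (1/2 + t))ᶜ
      ⊆ (Icc (-(3 * t)) (1/2 + 3 * t))ᶜ := by
    intro x hx hx'
    refine hx ⟨?_, ?_⟩ <;> dsimp only <;> linarith [hx'.1, hx'.2]
  calc μ (Icc (-t) (1/2 + t))ᶜ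
      = (2 : ℝ≥0∞)⁻¹ * μ ((fun x : ℝ => x / 3) ⁻¹' (Icc (-t) (1/2 + t))ᶜ)
        + (2 : ℝ≥0∞)⁻¹ * μ ((fun x : ℝ => x / 3 + 1/3) ⁻¹' (Icc (-t) (1/2 + t))ᶜ) := by
        conv_lhs => rw [h]
        rw [Measure.add_apply, Measure.smul_apply, Measure.smul_apply,
          Measure.map_apply (by fun_prop) hm, Measure.map_apply (by fun_prop) hm,
          smul_eq_mul, smul_eq_mul]
    _ ≤ (2 : ℝ≥0∞)⁻¹ * μ (Icc (-(3 * t)) (1/2 + 3 * t))ᶜ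
        + (2 : ℝ≥0∞)⁻¹ * μ (Icc (-(3 * t)) (1/2 + 3 * t))ᶜ := by gcongr
    _ = μ (Icc (-(3 * t)) (1/2 + 3 * t))ᶜ := by
        rw [← add_mul, ENNReal.inv_two_add_inv_two, one_mul]

variable [IsProbabilityMeasure μ]

lemma measure_outside_eq_zero (h : IsSelfSimilar μ) {t : ℝ} (ht : 0 < t) :
    μ (Icc (-t) (1/2 + t))ᶜ = 0 := by
  set s : ℕ → Set ℝ := fun k => (Icc (-(3 ^ k * t)) (1/2 + 3 ^ k * t))ᶜ with hs
  have hle : ∀ k, μ (Icc (-t) (1/2 + t))ᶜ ≤ μ (s k) := by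
    intro k
    induction k with
    | zero => simp [hs]
    | succ k ih =>
      refine ih.trans ((h.measure_outside_le _).trans_eq ?_)
      simp only [hs, pow_succ']
      ring_nf
  have hanti : Antitone s := by
    refine antitone_nat_of_succ_le fun k x hx hx' => hx ?_
    have : 0 < 3 ^ k * t := by positivity
    have e : (3 : ℝ) ^ (k + 1) * t = 3 * (3 ^ k * t) := by ring
    constructor <;> rw [e] <;> linarith [hx'.1, hx'.2]
  have hempty : ⋂ k, s k = ∅ := by
    refine Set.eq_empty_of_forall_notMem fun x hx => ?_
    obtain ⟨k, hk⟩ := pow_unbounded_of_one_lt (|x| / t) (by norm_num : (1 : ℝ) < 3)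
    have hk' : |x| < 3 ^ k * t := (div_lt_iff₀ ht).1 hk
    refine Set.mem_iInter.1 hx k ⟨?_, ?_⟩ <;> linarith [neg_abs_le x, le_abs_self x]
  have hlim := tendsto_measure_iInter_atTop (μ := μ) (s := s)
    (fun k => measurableSet_Icc.compl.nullMeasurableSet) hanti ⟨0, measure_ne_top _ _⟩
  rw [hempty, measure_empty] at hlim
  exact le_antisymm (ge_of_tendsto' hlim hle) zero_le

lemma ae_mem (h : IsSelfSimilar μ) : ∀ᵐ x ∂μ, x ∈ Icc (0 : ℝ) (1/2) := by
  have hk : ∀ k : ℕ, ∀ᵐ x ∂μ, x ∈ Icc (-(1 / ((k : ℝ) + 1))) (1/2 + 1 / ((k : ℝ) + 1)) :=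
    fun k => h.measure_outside_eq_zero (by positivity)
  filter_upwards [ae_all_iff.2 hk] with x hx
  have hlim : Tendsto (fun k : ℕ => 1 / ((k : ℝ) + 1)) atTop (nhds 0) :=
    tendsto_one_div_add_atTop_nhds_zero_nat
  constructor
  · simpa using le_of_tendsto' hlim.neg fun k => (hx k).1
  · simpa using ge_of_tendsto' (hlim.const_add (1/2)) fun k => (hx k).2

lemma integrable (h : IsSelfSimilar μ) {f : ℝ → ℝ} (hf : Continuous f) : Integrable f μ := by
  rw [← Measure.restrict_eq_self_of_ae_mem h.ae_mem]
  exact hf.integrableOn_Icc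

lemma integral_transfer (h : IsSelfSimilar μ) {f : ℝ → ℝ} (hf : Continuous f) :
    ∫ x, transfer f x ∂μ = ∫ x, f x ∂μ := by
  have i1 : Integrable (fun x => f (x / 3)) μ := h.integrable (by fun_prop)
  have i2 : Integrable (fun x => f (x / 3 + 1/3)) μ := h.integrable (by fun_prop)
  have j1 : Integrable f (μ.map (fun x => x / 3)) :=
    (integrable_map_measure hf.aestronglyMeasurable (by fun_prop)).2 i1
  have j2 : Integrable f (μ.map (fun x => x / 3 + 1/3)) :=
    (integrable_map_measure hf.aestronglyMeasurable (by fun_prop)).2 i2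
  conv_rhs => rw [h]
  rw [integral_add_measure (j1.smul_measure (by simp)) (j2.smul_measure (by simp)),
    integral_smul_measure, integral_smul_measure,
    integral_map (by fun_prop) hf.aestronglyMeasurable,
    integral_map (by fun_prop) hf.aestronglyMeasurable]
  simp only [transfer]
  rw [integral_div, integral_add i1 i2]
  simp only [ENNReal.toReal_inv, ENNReal.toReal_ofNat, smul_eq_mul]
  ring

lemma integral_mono (h : IsSelfSimilar μ) {f g : ℝ → ℝ} (hf : Continuous f) (hg : Continuous g)
    (hle : ∀ x ∈ Icc (0 : ℝ) (1/2), f x ≤ g x) : ∫ x, f x ∂μ ≤ ∫ x, g x ∂μ :=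
  integral_mono_ae (h.integrable hf) (h.integrable hg) (h.ae_mem.mono hle)

lemma le_integral (h : IsSelfSimilar μ) {f : ℝ → ℝ} (hf : Continuous f) {K : ℝ}
    (hle : ∀ x ∈ Icc (0 : ℝ) (1/2), K ≤ f x) : K ≤ ∫ x, f x ∂μ := by
  simpa using h.integral_mono continuous_const hf hle

/-- Lower bound for an integral from the eight translates of the third-level cylinder set. -/
lemma le_integral_of_le_sum (h : IsSelfSimilar μ) {f : ℝ → ℝ} (hf : Continuous f) {K : ℝ}
    (hle : ∀ y ∈ Icc (0 : ℝ) (1/54), 8 * K ≤ f y + f (y + 1/27) + f (y + 1/9) + f (y + 4/27)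
      + f (y + 1/3) + f (y + 10/27) + f (y + 4/9) + f (y + 13/27)) : K ≤ ∫ x, f x ∂μ := by
  have h1 := continuous_transfer hf
  have h2 := continuous_transfer h1
  rw [← h.integral_transfer hf, ← h.integral_transfer h1, ← h.integral_transfer h2]
  refine h.le_integral (continuous_transfer h2) fun x hx => ?_
  have := hle (x / 27) ⟨by linarith [hx.1], by linarith [hx.2]⟩
  simp only [transfer]
  ring_nf at this ⊢
  linarith

lemma integral_id (h : IsSelfSimilar μ) : ∫ x, x ∂μ = 1/4 := by
  have := h.integral_transfer (f := fun x => x) (by fun_prop)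
  have e : transfer (fun x => x) = fun x => x * (1/3) + 1/6 := by
    funext x; simp only [transfer]; ring
  rw [e, integral_add (h.integrable (by fun_prop)) (h.integrable (by fun_prop)),
    integral_mul_const, integral_const] at this
  simp at this
  linarith

lemma integral_sq (h : IsSelfSimilar μ) : ∫ x, x ^ 2 ∂μ = 3/32 := by
  have := h.integral_transfer (f := fun x => x ^ 2) (by fun_prop)
  have e : transfer (fun x => x ^ 2) = fun x => (x ^ 2 * (1/9) + x * (1/9)) + 1/18 := by
    funext x; simp only [transfer]; ring
  rw [e, integral_add (h.integrable (by fun_prop)) (h.integrable (by fun_prop)),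
    integral_add (h.integrable (by fun_prop)) (h.integrable (by fun_prop)),
    integral_mul_const, integral_mul_const, integral_const, h.integral_id] at this
  simp at this
  linarith

lemma integral_sub_sq (h : IsSelfSimilar μ) : ∫ x, (x - 1/4) ^ 2 ∂μ = 1/32 := by
  have e : (fun x : ℝ => (x - 1/4) ^ 2) = fun x => (x ^ 2 - x * (1/2)) + 1/16 := by
    funext x; ring
  rw [e, integral_add (h.integrable (by fun_prop)) (h.integrable (by fun_prop)),
    integral_sub (h.integrable (by fun_prop)) (h.integrable (by fun_prop)),
    integral_mul_const, integral_const, h.integral_id, h.integral_sq]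
  simp
  norm_num

lemma quantErr_le_two (h : IsSelfSimilar μ) {m : ℕ} (hm : 2 ≤ m) : quantErr μ m ≤ 1/288 := by
  have hne : ({1/12, 5/12} : Finset ℝ).Nonempty := by simp
  refine (quantErr_le hne (Finset.card_le_two.trans hm)).trans ?_
  have hc := continuous_nearestSq hne
  rw [distortion_eq, ← h.integral_transfer hc]
  have e : ∫ x, (x - 1/4) ^ 2 * (1/9) ∂μ = 1/288 := by
    rw [integral_mul_const, h.integral_sub_sq]; norm_num
  rw [← e]
  refine h.integral_mono (continuous_transfer hc) (by fun_prop) fun x _ => ?_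
  have h1 := nearestSq_le (β := {1/12, 5/12}) (c := 1/12) (by simp) (x / 3)
  have h2 := nearestSq_le (β := {1/12, 5/12}) (c := 5/12) (by simp) (x / 3 + 1/3)
  simp only [transfer]
  linarith

lemma quantErr_le_three (h : IsSelfSimilar μ) {m : ℕ} (hm : 3 ≤ m) :
    quantErr μ m ≤ 5/2592 := by
  have hne : ({1/12, 13/36, 17/36} : Finset ℝ).Nonempty := by simp
  refine (quantErr_le hne (Finset.card_le_three.trans hm)).trans ?_
  have hc := continuous_nearestSq hne
  have hc' := continuous_transfer hc
  rw [distortion_eq, ← h.integral_transfer hc, ← h.integral_transfer hc']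
  have e : ∫ x, (transfer (fun x => (x / 3 - 1/12) ^ 2 / 2) x + (x - 1/4) ^ 2 * (1/162)) ∂μ
      = 5/2592 := by
    have e2 : (fun x : ℝ => (x / 3 - 1/12) ^ 2 / 2) = fun x => (x - 1/4) ^ 2 * (1/18) := by
      funext x; ring
    rw [integral_add (h.integrable (continuous_transfer (by fun_prop)))
      (h.integrable (by fun_prop)), h.integral_transfer (by fun_prop), e2, integral_mul_const,
      integral_mul_const, h.integral_sub_sq]
    norm_num
  rw [← e]
  refine h.integral_mono (continuous_transfer hc')
    ((continuous_transfer (by fun_prop)).add (by fun_prop)) fun x _ => ?_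
  have h1 := nearestSq_le (β := {1/12, 13/36, 17/36}) (c := 1/12) (by simp) (x / 3 / 3)
  have h2 := nearestSq_le (β := {1/12, 13/36, 17/36}) (c := 1/12) (by simp) ((x / 3 + 1/3) / 3)
  have h3 := nearestSq_le (β := {1/12, 13/36, 17/36}) (c := 13/36) (by simp) (x / 3 / 3 + 1/3)
  have h4 := nearestSq_le (β := {1/12, 13/36, 17/36}) (c := 17/36) (by simp)
    ((x / 3 + 1/3) / 3 + 1/3)
  simp only [transfer]
  linarith

/-- Points of `β` that are dominated on `[0, 1/2]` by a subset may be discarded. -/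
lemma quantErr_le_of_dominated (h : IsSelfSimilar μ) {m : ℕ} {β δ : Finset ℝ}
    (hβ : β.Nonempty) (hδ : δ.Nonempty) (hcard : δ.card ≤ m)
    (hdom : ∀ x ∈ Icc (0 : ℝ) (1/2), ∀ c ∈ β, ∃ d ∈ δ, (x - d) ^ 2 ≤ (x - c) ^ 2) :
    quantErr μ m ≤ ∫ x, nearestSq β x ∂μ := by
  refine (quantErr_le hδ hcard).trans
    (h.integral_mono (continuous_nearestSq hδ) (continuous_nearestSq hβ) fun x hx => ?_)
  refine le_nearestSq hβ fun c hc => ?_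
  obtain ⟨d, hd, hle⟩ := hdom x hx c hc
  exact (nearestSq_le hd x).trans hle

/-- The cost on `{2/3, 5/6, 1}` compensates for the gain on `[0, 1/2]` when `a` is the only point
able to serve both. -/
lemma quantErr_le_of_gap (h : IsSelfSimilar μ) {m : ℕ} (hm : 2 ≤ m) {β ρ : Finset ℝ} {a b c : ℝ}
    (hβ : β.Nonempty) (hcov : ∀ q ∈ β, q ∈ ρ ∨ q = a ∨ q = b ∨ q = c) (hρ : ρ.card ≤ m)
    (ha : 0.5645 < a) (hab : a < b) (hac : a < c) (hgap : ∀ q ∈ ρ, q < 1 - a) :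
    quantErr μ m ≤ ∫ x, nearestSq β x ∂μ + (1/3) * (2/3 - a) ^ 2 := by
  have hc := continuous_nearestSq hβ
  have hnn := nearestSq_nonneg β
  have hright : ∀ x : ℝ, 1 - a ≤ x → x ≤ 1/2 → (x - (1 - a)) ^ 2 ≤ nearestSq β x := by
    intro x hx hx'
    refine le_nearestSq hβ fun q hq => ?_
    rcases hcov q hq with hq | rfl | rfl | rfl
    · nlinarith [hgap q hq]
    all_goals nlinarith
  have hr1 : ∀ y ∈ Icc (0 : ℝ) (1/54), (a - 5/9) ^ 2 ≤ nearestSq β (y + 4/9) := fun y hy =>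
    (by nlinarith [hy.1] : _ ≤ (y + 4/9 - (1 - a)) ^ 2).trans
      (hright _ (by linarith [hy.1]) (by linarith [hy.2]))
  have hr2 : ∀ y ∈ Icc (0 : ℝ) (1/54), (a - 14/27) ^ 2 ≤ nearestSq β (y + 13/27) := fun y hy =>
    (by nlinarith [hy.1] : _ ≤ (y + 13/27 - (1 - a)) ^ 2).trans
      (hright _ (by linarith [hy.1]) (by linarith [hy.2]))
  rcases hm.lt_or_eq with hm3 | rfl
  · refine (h.quantErr_le_three hm3).trans ?_
    have := h.le_integral_of_le_sum hc (K := ((a - 5/9) ^ 2 + (a - 14/27) ^ 2) / 8)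
      fun y hy => by
            linarith [hr1 y hy, hr2 y hy, hnn y, hnn (y + 1/27), hnn (y + 1/9), hnn (y + 4/27),
              hnn (y + 1/3), hnn (y + 10/27)]
    nlinarith [sq_nonneg (a - 11/18)]
  · refine (h.quantErr_le_two le_rfl).trans ?_
    by_cases hq : ∃ q ∈ ρ, 1/3 ≤ q
    · obtain ⟨q, hqρ, hq3⟩ := hq
      obtain ⟨p, hp⟩ : ∃ p, ∀ r ∈ ρ, r = p ∨ r = q := by
        have h1 : (ρ.erase q).card ≤ 1 := by
          rw [Finset.card_erase_of_mem hqρ]; omega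
        obtain ⟨p, hp⟩ := Finset.card_le_one_iff_subset_singleton.1 h1
        refine ⟨p, fun r hr => ?_⟩
        by_cases hrq : r = q
        · exact Or.inr hrq
        · exact Or.inl (Finset.mem_singleton.1 (hp (Finset.mem_erase.2 ⟨hrq, hr⟩)))
      obtain ⟨s, hs⟩ : ∃ s, ∀ x ∈ Icc (0 : ℝ) (1/6), (x - s) ^ 2 ≤ nearestSq β x := by
        have key : ∀ s ∈ Icc (0 : ℝ) (1/3), (∀ x ∈ Icc (0 : ℝ) (1/6), (x - s) ^ 2 ≤ (x - p) ^ 2) →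
            ∀ x ∈ Icc (0 : ℝ) (1/6), (x - s) ^ 2 ≤ nearestSq β x := by
          intro s hs hsp x hx
          obtain ⟨hx0, hx1⟩ := hx
          obtain ⟨hs0, hs1⟩ := hs
          have far : ∀ r : ℝ, 1/3 ≤ r → (x - s) ^ 2 ≤ (x - r) ^ 2 := fun r hr => by
            rw [← neg_sub r x, neg_sq]
            apply sq_le_sq' <;> linarith
          refine le_nearestSq hβ fun r hr => ?_
          rcases hcov r hr with hr | rfl | rfl | rfl
          · rcases hp r hr with rfl | rfl
            · exact hsp x ⟨hx0, hx1⟩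
            · exact far _ hq3
          all_goals exact far _ (by linarith)
        rcases le_total p 0 with hp0 | hp0
        · exact ⟨0, key 0 (by norm_num) fun x hx => by nlinarith [hx.1]⟩
        rcases le_total p (1/3) with hp1 | hp1
        · exact ⟨p, key p ⟨hp0, hp1⟩ fun x _ => le_rfl⟩
        · exact ⟨1/3, key (1/3) (by norm_num) fun x hx => by nlinarith [hx.2]⟩
      have := h.le_integral_of_le_sum hc
        (K := ((a - 5/9) ^ 2 + (a - 14/27) ^ 2 + 10/729) / 8) fun y hy => by
          obtain ⟨hy0, hy1⟩ := hy
          linarith [hr1 y ⟨hy0, hy1⟩, hr2 y ⟨hy0, hy1⟩, hnn (y + 1/3), hnn (y + 10/27),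
            hs y ⟨hy0, by linarith⟩, hs (y + 1/27) ⟨by linarith, by linarith⟩,
            hs (y + 1/9) ⟨by linarith, by linarith⟩, hs (y + 4/27) ⟨by linarith, by linarith⟩,
            sq_nonneg (y - s + 2/27)]
      nlinarith [sq_nonneg (a - 11/18)]
    · push Not at hq
      have hl : ∀ x : ℝ, 1/3 ≤ x → x ≤ 1/2 → ∀ r, r ≤ (x - 1/3) ^ 2 → r ≤ (a - x) ^ 2 →
          r ≤ nearestSq β x := by
        intro x hx hx' r h1 h2
        refine le_nearestSq hβ fun q hqβ => ?_
        rcases hcov q hqβ with hqρ | rfl | rfl | rfl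
        · nlinarith [hq q hqρ]
        all_goals nlinarith
      have hl1 : ∀ y ∈ Icc (0 : ℝ) (1/54), 0.0102 ≤ nearestSq β (y + 4/9) := fun y hy =>
        hl _ (by linarith [hy.1]) (by linarith [hy.2]) _ (by nlinarith [hy.1])
          (by nlinarith [hy.2])
      by_cases ha' : a - 1/2 ≤ 4/27
      · have hl2 : ∀ y ∈ Icc (0 : ℝ) (1/54), (a - 1/2) ^ 2 ≤ nearestSq β (y + 13/27) :=
          fun y hy => hl _ (by linarith [hy.1]) (by linarith [hy.2]) _ (by nlinarith [hy.1])
            (by nlinarith [hy.2])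
        have := h.le_integral_of_le_sum hc (K := ((a - 1/2) ^ 2 + 0.0102) / 8)
          fun y hy => by
            linarith [hl1 y hy, hl2 y hy, hnn y, hnn (y + 1/27), hnn (y + 1/9), hnn (y + 4/27),
              hnn (y + 1/3), hnn (y + 10/27)]
        nlinarith [sq_nonneg (a - 41/66)]
      · have hl2 : ∀ y ∈ Icc (0 : ℝ) (1/54), (4/27) ^ 2 ≤ nearestSq β (y + 13/27) :=
          fun y hy => hl _ (by linarith [hy.1]) (by linarith [hy.2]) _ (by nlinarith [hy.1])
            (by nlinarith [hy.2])
        have := h.le_integral_of_le_sum hc (K := ((4/27) ^ 2 + 0.0102) / 8)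
          fun y hy => by
            linarith [hl1 y hy, hl2 y hy, hnn y, hnn (y + 1/27), hnn (y + 1/9), hnn (y + 4/27),
              hnn (y + 1/3), hnn (y + 10/27)]
        nlinarith [sq_nonneg (2/3 - a)]

lemma quantErr_le_integral_add (h : IsSelfSimilar μ) {m : ℕ} (hm : 2 ≤ m) {β : Finset ℝ}
    (hβ : β.Nonempty) (hcard : β.card ≤ m + 3) :
    quantErr μ m ≤ ∫ x, nearestSq β x ∂μ
      + (1/3) * (nearestSq β (2/3) + nearestSq β (5/6) + nearestSq β 1) := by
  obtain ⟨a, ha, ea⟩ := exists_nearestSq_eq hβ (2/3)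
  obtain ⟨b, hb, eb⟩ := exists_nearestSq_eq hβ (5/6)
  obtain ⟨c, hc, ec⟩ := exists_nearestSq_eq hβ 1
  rw [ea, eb, ec]
  have hI : 0 ≤ ∫ x, nearestSq β x ∂μ := integral_nonneg (nearestSq_nonneg β)
  by_cases hD : 1/96 ≤ (2/3 - a) ^ 2 + (5/6 - b) ^ 2 + (1 - c) ^ 2
  · linarith [h.quantErr_le_two hm]
  push Not at hD
  have ha1 : 0.5645 < a := by nlinarith [sq_nonneg (5/6 - b), sq_nonneg (1 - c)]
  have hab : a < b := by
    by_contra! hle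
    nlinarith [sq_nonneg (1 - c), sq_nonneg ((a - 2/3) - (5/6 - b))]
  have hbc : b < c := by
    by_contra! hle
    nlinarith [sq_nonneg (2/3 - a), sq_nonneg ((b - 5/6) - (1 - c))]
  have hnn : 0 ≤ (2/3 - a) ^ 2 + (5/6 - b) ^ 2 + (1 - c) ^ 2 := by positivity
  have hcard3 : ∀ u, u ∈ β → u ≠ b → u ≠ c → (((β.erase u).erase b).erase c).card ≤ m := by
    intro u hu hub huc
    rw [Finset.card_erase_of_mem, Finset.card_erase_of_mem, Finset.card_erase_of_mem hu]
    · omega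
    · simp [hub.symm, hb]
    · simp [huc.symm, hbc.ne', hc]
  have hcardρ := hcard3 a ha hab.ne (hab.trans hbc).ne
  set ρ := ((β.erase a).erase b).erase c with hρ
  have hmem : ∀ q, q ∈ ρ ↔ q ≠ c ∧ q ≠ b ∧ q ≠ a ∧ q ∈ β := by simp [hρ]
  have hcov : ∀ q ∈ β, q ∈ ρ ∨ q = a ∨ q = b ∨ q = c := fun q hq => by
    rw [hmem]; tauto
  by_cases hgap : ∀ q ∈ ρ, q < 1 - a
  · have := h.quantErr_le_of_gap hm hβ hcov hcardρ ha1 hab (hab.trans hbc) hgap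
    linarith [sq_nonneg (5/6 - b), sq_nonneg (1 - c)]
  push Not at hgap
  obtain ⟨q, hqρ, hq⟩ := hgap
  obtain ⟨hqc, hqb, hqa, hqβ⟩ := (hmem q).1 hqρ
  suffices quantErr μ m ≤ ∫ x, nearestSq β x ∂μ by linarith
  rcases lt_or_ge a q with haq | hqa'
  · have haδ : a ∈ ((β.erase q).erase b).erase c := by
      simp [ha, hab.ne, (hab.trans hbc).ne, haq.ne]
    refine h.quantErr_le_of_dominated hβ ⟨a, haδ⟩ (hcard3 q hqβ hqb hqc) fun x hx r hr => ?_
    have hx2 := hx.2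
    by_cases hr' : r ∈ ((β.erase q).erase b).erase c
    · exact ⟨r, hr', le_rfl⟩
    · have : a ≤ r := by
        simp only [Finset.mem_erase, not_and_or, not_not] at hr'
        rcases hr' with rfl | rfl | rfl | hr'
        · linarith
        · linarith
        · linarith
        · exact absurd hr hr'
      exact ⟨a, haδ, by nlinarith⟩
  · refine h.quantErr_le_of_dominated hβ ⟨q, hqρ⟩ hcardρ fun x hx r hr => ?_
    have hx2 := hx.2
    have hxa : (x - q) ^ 2 ≤ (x - a) ^ 2 := by nlinarith
    rcases hcov r hr with hr' | rfl | rfl | rfl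
    · exact ⟨r, hr', le_rfl⟩
    · exact ⟨q, hqρ, hxa⟩
    · exact ⟨q, hqρ, hxa.trans (by nlinarith)⟩
    · exact ⟨q, hqρ, hxa.trans (by nlinarith)⟩

lemma distortion_mix (h : IsSelfSimilar μ) {β : Finset ℝ} (hβ : β.Nonempty) :
    distortion (mix μ discD) β = (1/2) * (∫ x, nearestSq β x ∂μ
      + (1/3) * (nearestSq β (2/3) + nearestSq β (5/6) + nearestSq β 1)) := by
  have hi := h.integrable (continuous_nearestSq hβ)
  have hd : ∀ x : ℝ, Integrable (nearestSq β) (Measure.dirac x) := fun x =>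
    integrable_dirac (by simp)
  have hD : Integrable (nearestSq β) discD :=
    (((hd _).add_measure (hd _)).add_measure (hd _)).smul_measure (by simp)
  rw [distortion_eq, mix,
    integral_add_measure (hi.smul_measure (by simp)) (hD.smul_measure (by simp)),
    integral_smul_measure, integral_smul_measure, discD, integral_smul_measure,
    integral_add_measure ((hd _).add_measure (hd _)) (hd _),
    integral_add_measure (hd _) (hd _), integral_dirac, integral_dirac, integral_dirac]
  simp only [ENNReal.toReal_inv, ENNReal.toReal_ofNat, smul_eq_mul]
  ring

end IsSelfSimilar

theorem stmt13 (P₁ : Measure ℝ) [IsProbabilityMeasure P₁]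
    (hP₁ : P₁ = (2 : ℝ≥0∞)⁻¹ • P₁.map (fun x => x / 3) +
      (2 : ℝ≥0∞)⁻¹ • P₁.map (fun x => x / 3 + 1/3))
    (P : Measure ℝ) (hP : P = mix P₁ discD)
    (n : ℕ) (hn : 5 ≤ n) (γ : Finset ℝ) (hγ : IsOptimalSet P₁ (n - 3) γ) :
    IsOptimalSet P n (γ ∪ ({2/3, 5/6, 1} : Finset ℝ)) ∧
    quantErr P n = (1/2) * quantErr P₁ (n - 3) := by
  have h : IsSelfSimilar P₁ := hP₁
  obtain ⟨hne, hcard, hopt⟩ := hγ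
  set δ := γ ∪ ({2/3, 5/6, 1} : Finset ℝ) with hδ
  have hδne : δ.Nonempty := hne.mono Finset.subset_union_left
  have hδcard : δ.card ≤ n := by
    have h1 : δ.card ≤ _ := Finset.card_union_le γ ({2/3, 5/6, 1} : Finset ℝ)
    have h2 : ({2/3, 5/6, 1} : Finset ℝ).card ≤ 3 := Finset.card_le_three
    omega
  have hupper : distortion P δ ≤ (1/2) * quantErr P₁ (n - 3) := by
    rw [hP, h.distortion_mix hδne, nearestSq_eq_zero (by simp [hδ]),
      nearestSq_eq_zero (by simp [hδ]), nearestSq_eq_zero (by simp [hδ]), ← hopt, distortion_eq]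
    have := h.integral_mono (continuous_nearestSq hδne) (continuous_nearestSq hne) fun x _ =>
      le_nearestSq hne fun c hc => nearestSq_le (Finset.mem_union_left _ hc) x
    linarith
  have hlower : (1/2) * quantErr P₁ (n - 3) ≤ quantErr P n := by
    refine le_csInf ⟨_, δ, hδne, hδcard, rfl⟩ ?_
    rintro v ⟨β, hβ, hβcard, rfl⟩
    rw [hP, h.distortion_mix hβ]
    have := h.quantErr_le_integral_add (m := n - 3) (by omega) hβ (by omega)
    linarith
  have hmid := quantErr_le (P := P) hδne hδcard
  exact ⟨⟨hδne, hδcard, by linarith⟩, by linarith⟩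
end

section
/- Let P₁ be the self-similar Cantor measure with contraction ratio 1/3 on [0,1/2] (P₁ = (1/2)P₁∘S₁⁻¹ + (1/2)P₁∘S₂⁻¹, S₁(x)=x/3, S₂(x)=x/3+1/3), P₂ the uniform discrete measure on D = {2/3, 5/6, 1}, and P = (1/2)P₁ + (1/2)P₂. Then the quantization dimension of P exists and equals log 2 / log 3, which equals the quantization dimension of P₁. -/
open MeasureTheory Set Filter Real
open scoped ENNReal

/-- The two contractions defining the Cantor measure leave it invariant. -/
def IsCantorInvariant (P : Measure ℝ) : Prop :=
  P = (2 : ℝ≥0∞)⁻¹ • P.map (fun x => x / 3) + (2 : ℝ≥0∞)⁻¹ • P.map (fun x => x / 3 + 1/3)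

lemma IsCantorInvariant.real_apply {P : Measure ℝ} [IsProbabilityMeasure P]
    (hP : IsCantorInvariant P) {s : Set ℝ} (hs : MeasurableSet s) :
    P.real s = 1/2 * P.real ((fun x => x / 3) ⁻¹' s)
      + 1/2 * P.real ((fun x => x / 3 + 1/3) ⁻¹' s) := by
  have h : P s = (2 : ℝ≥0∞)⁻¹ * P ((fun x => x / 3) ⁻¹' s)
      + (2 : ℝ≥0∞)⁻¹ * P ((fun x => x / 3 + 1/3) ⁻¹' s) := by
    conv_lhs => rw [hP]
    rw [Measure.add_apply, Measure.smul_apply, Measure.smul_apply,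
      Measure.map_apply (by fun_prop) hs, Measure.map_apply (by fun_prop) hs]
    rfl
  rw [measureReal_def, h, ENNReal.toReal_add (by finiteness) (by finiteness)]
  simp [measureReal_def]

lemma IsCantorInvariant.ae_of_ae {P : Measure ℝ} (hP : IsCantorInvariant P) {p : ℝ → Prop}
    (hp : MeasurableSet {x | p x}) (h₁ : ∀ᵐ x ∂P, p (x / 3)) (h₂ : ∀ᵐ x ∂P, p (x / 3 + 1/3)) :
    ∀ᵐ x ∂P, p x := by
  rw [hP, ae_add_measure_iff]
  exact ⟨Measure.ae_smul_measure ((ae_map_iff (by fun_prop) hp).2 h₁) _,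
    Measure.ae_smul_measure ((ae_map_iff (by fun_prop) hp).2 h₂) _⟩

lemma IsCantorInvariant.real_Icc_le {P : Measure ℝ} [IsProbabilityMeasure P]
    (hP : IsCantorInvariant P) (r : ℝ) (k : ℕ) :
    P.real (Icc (-(3 ^ k * r)) (1/2 + 3 ^ k * r)) ≤ P.real (Icc (-r) (1/2 + r)) := by
  induction k with
  | zero => simp
  | succ k ih =>
    refine le_trans ?_ ih
    rw [hP.real_apply (s := Icc (-(3 ^ k * r)) _) measurableSet_Icc]
    have h₁ : P.real (Icc (-(3 ^ (k + 1) * r)) (1/2 + 3 ^ (k + 1) * r)) ≤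
        P.real ((fun x => x / 3) ⁻¹' Icc (-(3 ^ k * r)) (1/2 + 3 ^ k * r)) := by
      refine measureReal_mono fun x hx => ?_
      simp only [mem_preimage, mem_Icc, pow_succ] at hx ⊢
      constructor <;> linarith [hx.1, hx.2]
    have h₂ : P.real (Icc (-(3 ^ (k + 1) * r)) (1/2 + 3 ^ (k + 1) * r)) ≤
        P.real ((fun x => x / 3 + 1/3) ⁻¹' Icc (-(3 ^ k * r)) (1/2 + 3 ^ k * r)) := by
      refine measureReal_mono fun x hx => ?_
      simp only [mem_preimage, mem_Icc, pow_succ] at hx ⊢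
      constructor <;> linarith [hx.1, hx.2]
    linarith

lemma IsCantorInvariant.ae_mem_Icc {P : Measure ℝ} [IsProbabilityMeasure P]
    (hP : IsCantorInvariant P) : ∀ᵐ x ∂P, x ∈ Icc (0 : ℝ) (1/2) := by
  have key : ∀ r : ℝ, 0 < r → ∀ᵐ x ∂P, x ∈ Icc (-r) (1/2 + r) := by
    intro r hr
    have hmono : Monotone fun k : ℕ => Icc (-(3 ^ k * r)) (1/2 + 3 ^ k * r) := by
      intro a b hab
      have : (3 : ℝ) ^ a * r ≤ 3 ^ b * r := by gcongr; norm_num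
      exact Icc_subset_Icc (by linarith) (by linarith)
    have hunion : ⋃ k : ℕ, Icc (-(3 ^ k * r)) (1/2 + 3 ^ k * r) = univ := by
      refine eq_univ_of_forall fun x => mem_iUnion.2 ?_
      obtain ⟨k, hk⟩ := pow_unbounded_of_one_lt (|x| / r) (by norm_num : (1 : ℝ) < 3)
      rw [div_lt_iff₀ hr] at hk
      exact ⟨k, by linarith [neg_abs_le x], by linarith [le_abs_self x]⟩
    have hlim := tendsto_measure_iUnion_atTop (μ := P) hmono
    rw [hunion, measure_univ] at hlim
    have hlim' := (ENNReal.tendsto_toReal ENNReal.one_ne_top).comp hlim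
    have hge : (1 : ℝ) ≤ P.real (Icc (-r) (1/2 + r)) :=
      le_of_tendsto' hlim' fun k => hP.real_Icc_le r k
    have hone : P.real (Icc (-r) (1/2 + r)) = 1 := le_antisymm measureReal_le_one hge
    rw [measureReal_def, ENNReal.toReal_eq_one_iff] at hone
    exact (mem_ae_iff_prob_eq_one measurableSet_Icc).2 hone
  have hall : ∀ᵐ x ∂P, ∀ m : ℕ, x ∈ Icc (-(1 / ((m : ℝ) + 1))) (1/2 + 1 / ((m : ℝ) + 1)) :=
    ae_all_iff.2 fun m => key _ (by positivity)
  filter_upwards [hall] with x hx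
  have hlim := tendsto_one_div_add_atTop_nhds_zero_nat (𝕜 := ℝ)
  constructor
  · have := hlim.neg
    rw [neg_zero] at this
    exact le_of_tendsto' this fun m => (hx m).1
  · have := hlim.const_add (1/2)
    rw [add_zero] at this
    exact ge_of_tendsto' this fun m => (hx m).2

lemma IsCantorInvariant.real_Icc_le_pow {P : Measure ℝ} [IsProbabilityMeasure P]
    (hP : IsCantorInvariant P) (k : ℕ) (a b : ℝ) (hab : b - a < 1/2 * (1/3) ^ k) :
    P.real (Icc a b) ≤ (1/2) ^ k := by
  induction k generalizing a b with
  | zero => simp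
  | succ k ih =>
    have hpow : ((1 : ℝ)/3) ^ k ≤ 1 := pow_le_one₀ (by norm_num) (by norm_num)
    rw [pow_succ] at hab
    have e₁ : (fun x : ℝ => x / 3) ⁻¹' Icc a b = Icc (3 * a) (3 * b) := by
      ext x; simp only [mem_preimage, mem_Icc]; constructor <;> rintro ⟨h, h'⟩ <;>
        constructor <;> linarith
    have e₂ : (fun x : ℝ => x / 3 + 1/3) ⁻¹' Icc a b = Icc (3 * a - 1) (3 * b - 1) := by
      ext x; simp only [mem_preimage, mem_Icc]; constructor <;> rintro ⟨h, h'⟩ <;>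
        constructor <;> linarith
    have i₁ := ih (3 * a) (3 * b) (by linarith)
    have i₂ := ih (3 * a - 1) (3 * b - 1) (by linarith)
    have hzero : P.real (Icc (3 * a) (3 * b)) = 0 ∨ P.real (Icc (3 * a - 1) (3 * b - 1)) = 0 := by
      by_cases ha : 1/6 < a
      · left
        rw [measureReal_eq_zero_iff, ← compl_mem_ae_iff]
        filter_upwards [hP.ae_mem_Icc] with x hx hx'
        linarith [hx.2, hx'.1]
      · right
        rw [measureReal_eq_zero_iff, ← compl_mem_ae_iff]
        filter_upwards [hP.ae_mem_Icc] with x hx hx'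
        linarith [hx.1, hx'.2]
    rw [hP.real_apply measurableSet_Icc, e₁, e₂, pow_succ]
    rcases hzero with h | h <;> rw [h] <;> linarith

/-- The covering property behind the upper bound for quantization errors. -/
def HasCantorNets (Q : Measure ℝ) : Prop :=
  ∀ k : ℕ, ∃ γ : Finset ℝ, γ.Nonempty ∧ γ.card ≤ 2 ^ k + 3 ∧
    ∀ᵐ x ∂Q, ∃ c ∈ γ, |x - c| ≤ (1/3) ^ k

/-- The spreading property behind the lower bound for quantization errors. -/
def IsCantorSpread (Q : Measure ℝ) : Prop :=
  ∀ (k : ℕ) (γ : Finset ℝ), γ.Nonempty → γ.card ≤ 2 ^ k →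
    1/4 ≤ Q.real {x | (1/5 * (1/3) ^ (k + 1)) ^ 2 ≤ ⨅ c : γ, (x - (c : ℝ)) ^ 2}

lemma measurableSet_exists_abs_sub_le (γ : Finset ℝ) (r : ℝ) :
    MeasurableSet {x : ℝ | ∃ c ∈ γ, |x - c| ≤ r} := by
  have : {x : ℝ | ∃ c ∈ γ, |x - c| ≤ r} = ⋃ c ∈ γ, {x : ℝ | |x - c| ≤ r} := by
    ext; simp
  rw [this]
  exact Finset.measurableSet_biUnion _ fun c _ => measurableSet_le (by fun_prop) (by fun_prop)

lemma IsCantorInvariant.exists_net {P : Measure ℝ} [IsProbabilityMeasure P]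
    (hP : IsCantorInvariant P) (k : ℕ) : ∃ γ : Finset ℝ, γ.Nonempty ∧ γ.card ≤ 2 ^ k ∧
      ∀ᵐ x ∂P, ∃ c ∈ γ, |x - c| ≤ (1/3) ^ k := by
  induction k with
  | zero =>
    refine ⟨{0}, by simp, by simp, ?_⟩
    filter_upwards [hP.ae_mem_Icc] with x hx
    refine ⟨0, by simp, ?_⟩
    rw [pow_zero, sub_zero, abs_le]
    constructor <;> linarith [hx.1, hx.2]
  | succ k ih =>
    obtain ⟨γ, hne, hcard, hγ⟩ := ih
    refine ⟨γ.image (fun x => x / 3) ∪ γ.image (fun x => x / 3 + 1/3),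
      (hne.image _).mono Finset.subset_union_left, ?_, ?_⟩
    · refine (Finset.card_union_le _ _).trans ?_
      have h₁ := Finset.card_image_le (s := γ) (f := fun x => x / 3)
      have h₂ := Finset.card_image_le (s := γ) (f := fun x => x / 3 + 1/3)
      rw [pow_succ]
      omega
    · refine hP.ae_of_ae (measurableSet_exists_abs_sub_le _ _) ?_ ?_
      · filter_upwards [hγ] with x ⟨c, hc, hxc⟩
        refine ⟨c / 3, Finset.mem_union_left _ (Finset.mem_image_of_mem (fun x => x / 3) hc), ?_⟩
        rw [abs_le] at hxc ⊢
        rw [pow_succ]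
        constructor <;> linarith [hxc.1, hxc.2]
      · filter_upwards [hγ] with x ⟨c, hc, hxc⟩
        refine ⟨c / 3 + 1/3,
          Finset.mem_union_right _ (Finset.mem_image_of_mem (fun x => x / 3 + 1/3) hc), ?_⟩
        rw [abs_le] at hxc ⊢
        rw [pow_succ]
        constructor <;> linarith [hxc.1, hxc.2]

lemma IsCantorInvariant.hasCantorNets {P : Measure ℝ} [IsProbabilityMeasure P]
    (hP : IsCantorInvariant P) : HasCantorNets P := fun k => by
  obtain ⟨γ, hne, hcard, hγ⟩ := hP.exists_net k
  exact ⟨γ, hne, by omega, hγ⟩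

lemma IsCantorInvariant.hasCantorNets_mix {P : Measure ℝ} [IsProbabilityMeasure P]
    (hP : IsCantorInvariant P) : HasCantorNets (mix P discD) := fun k => by
  obtain ⟨γ, hne, hcard, hγ⟩ := hP.exists_net k
  refine ⟨γ ∪ {2/3, 5/6, 1}, hne.mono Finset.subset_union_left, ?_, ?_⟩
  · refine (Finset.card_union_le _ _).trans ?_
    have := Finset.card_le_three (a := (2/3 : ℝ)) (b := 5/6) (c := 1)
    omega
  · rw [mix, discD, ae_add_measure_iff]
    refine ⟨Measure.ae_smul_measure ?_ _, Measure.ae_smul_measure (Measure.ae_smul_measure ?_ _) _⟩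
    · filter_upwards [hγ] with x ⟨c, hc, hxc⟩
      exact ⟨c, Finset.mem_union_left _ hc, hxc⟩
    · rw [ae_add_measure_iff, ae_add_measure_iff]
      refine ⟨⟨?_, ?_⟩, ?_⟩ <;> rw [ae_dirac_iff (measurableSet_exists_abs_sub_le _ _)]
      · exact ⟨2/3, by simp, by simp⟩
      · exact ⟨5/6, by simp, by simp⟩
      · exact ⟨1, by simp, by simp⟩

lemma measurable_iInf_sq_sub (γ : Finset ℝ) :
    Measurable fun x : ℝ => ⨅ c : γ, (x - (c : ℝ)) ^ 2 :=
  Measurable.iInf fun _ => by fun_prop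

lemma iInf_sq_sub_le {γ : Finset ℝ} (x : ℝ) {c : ℝ} (hc : c ∈ γ) :
    ⨅ c : γ, (x - (c : ℝ)) ^ 2 ≤ (x - c) ^ 2 :=
  ciInf_le (f := fun c : γ => (x - (c : ℝ)) ^ 2)
    ⟨0, by rintro _ ⟨c, rfl⟩; positivity⟩ ⟨c, hc⟩

lemma iInf_sq_sub_nonneg (γ : Finset ℝ) (x : ℝ) : 0 ≤ ⨅ c : γ, (x - (c : ℝ)) ^ 2 :=
  Real.iInf_nonneg fun _ => by positivity

lemma IsCantorInvariant.half_le_real {P : Measure ℝ} [IsProbabilityMeasure P]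
    (hP : IsCantorInvariant P) (k : ℕ) (γ : Finset ℝ) (hne : γ.Nonempty) (hcard : γ.card ≤ 2 ^ k) :
    1/2 ≤ P.real {x | (1/5 * (1/3) ^ (k + 1)) ^ 2 ≤ ⨅ c : γ, (x - (c : ℝ)) ^ 2} := by
  set r : ℝ := 1/5 * (1/3) ^ (k + 1) with hr
  have hr0 : 0 < r := by positivity
  have hmeas : MeasurableSet {x : ℝ | r ^ 2 ≤ ⨅ c : γ, (x - (c : ℝ)) ^ 2} :=
    measurableSet_le measurable_const (measurable_iInf_sq_sub γ)
  have hsub : {x : ℝ | r ^ 2 ≤ ⨅ c : γ, (x - (c : ℝ)) ^ 2}ᶜ ⊆ ⋃ c ∈ γ, Icc (c - r) (c + r) := by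
    intro x hx
    simp only [mem_compl_iff, mem_ofPred_eq, not_le] at hx
    have : Nonempty γ := hne.to_subtype
    obtain ⟨c, hc⟩ := exists_lt_of_ciInf_lt hx
    have := abs_le.1 (abs_lt_of_sq_lt_sq hc hr0.le).le
    exact mem_biUnion c.2 ⟨by linarith [this.1], by linarith [this.2]⟩
  have hsmall : P.real {x : ℝ | r ^ 2 ≤ ⨅ c : γ, (x - (c : ℝ)) ^ 2}ᶜ ≤ 1/2 :=
    calc _ ≤ P.real (⋃ c ∈ γ, Icc (c - r) (c + r)) := measureReal_mono hsub (measure_ne_top _ _)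
      _ ≤ ∑ c ∈ γ, P.real (Icc (c - r) (c + r)) := measureReal_biUnion_finset_le _ _
      _ ≤ ∑ _c ∈ γ, (1/2 : ℝ) ^ (k + 1) := Finset.sum_le_sum fun c _ =>
          hP.real_Icc_le_pow _ _ _ (by
            have : (0 : ℝ) < (1/3) ^ (k + 1) := by positivity
            linarith)
      _ = γ.card * (1/2 : ℝ) ^ (k + 1) := by rw [Finset.sum_const, nsmul_eq_mul]
      _ ≤ 2 ^ k * (1/2 : ℝ) ^ (k + 1) := by gcongr; exact_mod_cast hcard
      _ = 1/2 := by rw [pow_succ, ← mul_assoc, ← mul_pow]; norm_num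
  rw [probReal_compl_eq_one_sub hmeas] at hsmall
  linarith

lemma IsCantorInvariant.isCantorSpread {P : Measure ℝ} [IsProbabilityMeasure P]
    (hP : IsCantorInvariant P) : IsCantorSpread P := fun k γ hne hcard => by
  linarith [hP.half_le_real k γ hne hcard]

instance : IsProbabilityMeasure discD := ⟨by
  simp only [discD, Measure.smul_apply, Measure.add_apply, measure_univ, smul_eq_mul]
  rw [show (1 + 1 + 1 : ℝ≥0∞) = 3 by norm_num]
  exact ENNReal.inv_mul_cancel (by norm_num) (by norm_num)⟩

instance (P Q : Measure ℝ) [IsProbabilityMeasure P] [IsProbabilityMeasure Q] :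
    IsProbabilityMeasure (mix P Q) := ⟨by
  simp [mix, ENNReal.inv_two_add_inv_two]⟩

lemma half_real_le_real_mix (P Q : Measure ℝ) [IsProbabilityMeasure P] [IsProbabilityMeasure Q]
    (s : Set ℝ) : 1/2 * P.real s ≤ (mix P Q).real s := by
  have h : (2 : ℝ≥0∞)⁻¹ * P s ≤ mix P Q s := by
    rw [mix, Measure.add_apply, Measure.smul_apply]
    exact le_self_add
  have := ENNReal.toReal_mono (by finiteness) h
  simpa [measureReal_def] using this

lemma IsCantorInvariant.isCantorSpread_mix {P : Measure ℝ} [IsProbabilityMeasure P]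
    (hP : IsCantorInvariant P) : IsCantorSpread (mix P discD) := fun k γ hne hcard => by
  linarith [hP.half_le_real k γ hne hcard, half_real_le_real_mix P discD
    {x | (1/5 * (1/3) ^ (k + 1)) ^ 2 ≤ ⨅ c : γ, (x - (c : ℝ)) ^ 2}]

lemma distortion_nonneg (Q : Measure ℝ) (γ : Finset ℝ) : 0 ≤ distortion Q γ :=
  integral_nonneg fun x => iInf_sq_sub_nonneg γ x

lemma HasCantorNets.integrable {Q : Measure ℝ} [IsProbabilityMeasure Q] (hQ : HasCantorNets Q)
    {γ : Finset ℝ} (hne : γ.Nonempty) :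
    Integrable (fun x : ℝ => ⨅ c : γ, (x - (c : ℝ)) ^ 2) Q := by
  obtain ⟨δ, -, -, hδ⟩ := hQ 0
  obtain ⟨a, ha⟩ := hne
  refine Integrable.of_bound (measurable_iInf_sq_sub γ).aestronglyMeasurable
    (∑ c ∈ δ, (1 + |c - a|) ^ 2) ?_
  filter_upwards [hδ] with x ⟨c, hc, hxc⟩
  rw [Real.norm_of_nonneg (iInf_sq_sub_nonneg γ x)]
  have h₁ : |x - a| ≤ 1 + |c - a| := by
    have := abs_sub_le x c a
    rw [pow_zero] at hxc
    linarith
  calc _ ≤ (x - a) ^ 2 := iInf_sq_sub_le x ha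
    _ = |x - a| ^ 2 := (sq_abs _).symm
    _ ≤ (1 + |c - a|) ^ 2 := by gcongr
    _ ≤ _ := Finset.single_le_sum (f := fun c => (1 + |c - a|) ^ 2)
        (fun _ _ => by positivity) hc

lemma HasCantorNets.quantErr_le {Q : Measure ℝ} [IsProbabilityMeasure Q] (hQ : HasCantorNets Q)
    {k n : ℕ} (hn : 2 ^ k + 3 ≤ n) : quantErr Q n ≤ ((1/3) ^ k) ^ 2 := by
  obtain ⟨γ, hne, hcard, hγ⟩ := hQ k
  have hle : quantErr Q n ≤ distortion Q γ := by
    refine csInf_le ⟨0, ?_⟩ ⟨γ, hne, hcard.trans hn, rfl⟩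
    rintro _ ⟨δ, -, -, rfl⟩
    exact distortion_nonneg Q δ
  have hbound : distortion Q γ ≤ ∫ _x, ((1/3 : ℝ) ^ k) ^ 2 ∂Q := by
    refine integral_mono_ae (hQ.integrable hne) (integrable_const _) ?_
    filter_upwards [hγ] with x ⟨c, hc, hxc⟩
    refine (iInf_sq_sub_le x hc).trans ?_
    rw [← sq_abs]
    gcongr
  exact hle.trans (by simpa using hbound)

lemma IsCantorSpread.le_quantErr {Q : Measure ℝ} [IsProbabilityMeasure Q] (hQ : IsCantorSpread Q)
    (hQ' : HasCantorNets Q) {k n : ℕ} (hn₁ : 1 ≤ n) (hn : n ≤ 2 ^ k) :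
    1/4 * (1/5 * (1/3) ^ (k + 1)) ^ 2 ≤ quantErr Q n := by
  refine le_csInf ⟨_, {0}, by simp, by simpa using hn₁, rfl⟩ ?_
  rintro _ ⟨γ, hne, hcard, rfl⟩
  have hmarkov := mul_meas_ge_le_integral_of_nonneg
    (ae_of_all Q fun x => iInf_sq_sub_nonneg γ x) (hQ'.integrable hne)
    ((1/5 * (1/3) ^ (k + 1)) ^ 2)
  have := mul_le_mul_of_nonneg_left (hQ k γ hne (hcard.trans hn))
    (sq_nonneg (1/5 * (1/3 : ℝ) ^ (k + 1)))
  calc _ = (1/5 * (1/3 : ℝ) ^ (k + 1)) ^ 2 * (1/4) := mul_comm _ _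
    _ ≤ _ := this
    _ ≤ _ := hmarkov

lemma tendsto_div_of_abs_sub_mul_le {ι : Type*} {l : Filter ι} {u k : ι → ℝ} {a C : ℝ}
    (hk : Tendsto k l atTop) (h : ∀ᶠ i in l, |u i - k i * a| ≤ C) :
    Tendsto (fun i => u i / k i) l (nhds a) := by
  rw [tendsto_iff_norm_sub_tendsto_zero]
  refine squeeze_zero' (.of_forall fun _ => norm_nonneg _) ?_ (hk.const_div_atTop C)
  filter_upwards [h, hk.eventually_gt_atTop 0] with i hi hpos
  rw [Real.norm_eq_abs, div_sub' hpos.ne', abs_div, abs_of_pos hpos]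
  gcongr

lemma tendsto_quantization_dimension {Q : Measure ℝ} [IsProbabilityMeasure Q]
    (hQ : HasCantorNets Q) (hQ' : IsCantorSpread Q) :
    Tendsto (fun n : ℕ => 2 * Real.log n / (- Real.log (quantErr Q n))) atTop
      (nhds (Real.log 2 / Real.log 3)) := by
  have hlog2 : 0 < Real.log 2 := Real.log_pos (by norm_num)
  have hlog3 : 0 < Real.log 3 := Real.log_pos (by norm_num)
  have hk : Tendsto (fun n : ℕ => ((Nat.log 2 n : ℕ) : ℝ)) atTop atTop :=
    tendsto_natCast_atTop_atTop.comp <| tendsto_atTop.2 fun b => by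
      filter_upwards [eventually_ge_atTop (2 ^ b)] with n hn
      exact Nat.le_log_of_pow_le (by norm_num) hn
  have hnum : Tendsto (fun n : ℕ => Real.log n / (Nat.log 2 n : ℕ)) atTop (nhds (Real.log 2)) := by
    refine tendsto_div_of_abs_sub_mul_le (C := Real.log 2) hk ?_
    filter_upwards [eventually_ge_atTop 1] with n hn
    have hn0 : (0 : ℝ) < n := by exact_mod_cast hn
    have h₁ : (2 : ℝ) ^ Nat.log 2 n ≤ n := by exact_mod_cast Nat.pow_log_le_self 2 (by omega)
    have h₂ : (n : ℝ) ≤ 2 ^ (Nat.log 2 n + 1) := by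
      exact_mod_cast (Nat.lt_pow_succ_log_self (by norm_num) n).le
    have h₁' := Real.log_le_log (by positivity) h₁
    have h₂' := Real.log_le_log hn0 h₂
    rw [Real.log_pow] at h₁' h₂'
    push_cast at h₂'
    rw [abs_le]
    constructor <;> linarith
  have hden : Tendsto (fun n : ℕ => -Real.log (quantErr Q n) / (Nat.log 2 n : ℕ)) atTop
      (nhds (2 * Real.log 3)) := by
    refine tendsto_div_of_abs_sub_mul_le (C := 4 * Real.log 3 + Real.log 100) hk ?_
    filter_upwards [eventually_ge_atTop 8] with n hn
    obtain ⟨m, hm⟩ : ∃ m, Nat.log 2 n = m + 3 :=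
      ⟨Nat.log 2 n - 3, by have := (Nat.le_log_iff_pow_le (b := 2) (x := 3) (by norm_num)
        (by omega : n ≠ 0)).2 (by omega); omega⟩
    have hlow : 2 ^ (m + 3) ≤ n := hm ▸ Nat.pow_log_le_self 2 (by omega)
    have hupp : n ≤ 2 ^ (m + 4) := by
      have := (Nat.lt_pow_succ_log_self (b := 2) (by norm_num) n).le
      rwa [hm] at this
    have hu : quantErr Q n ≤ ((1/3) ^ (m + 2)) ^ 2 := hQ.quantErr_le (by
      have := Nat.one_le_two_pow (n := m)
      rw [pow_add] at hlow ⊢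
      omega)
    have hl := hQ'.le_quantErr hQ (by omega) hupp
    have hl' := Real.log_le_log (by positivity) hl
    have hu' := Real.log_le_log (lt_of_lt_of_le (by positivity) hl) hu
    have e : (1/4 * (1/5 * (1/3 : ℝ) ^ (m + 4 + 1)) ^ 2) = (100 * 3 ^ (2 * (m + 5)))⁻¹ := by
      rw [one_div_pow]; field_simp; ring
    have e' : ((1/3 : ℝ) ^ (m + 2)) ^ 2 = (3 ^ (2 * (m + 2)))⁻¹ := by
      rw [one_div_pow]; field_simp; ring
    rw [e, Real.log_inv, Real.log_mul (by norm_num) (by positivity), Real.log_pow] at hl'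
    rw [e', Real.log_inv, Real.log_pow] at hu'
    have hlog100 : 0 < Real.log 100 := Real.log_pos (by norm_num)
    rw [hm]
    push_cast at hl' hu' ⊢
    rw [abs_le]
    constructor <;> linarith
  have hlim := (hnum.const_mul 2).div hden (by positivity)
  rw [mul_div_mul_left _ _ (by norm_num : (2 : ℝ) ≠ 0)] at hlim
  refine hlim.congr' ?_
  filter_upwards [hk.eventually_gt_atTop 0] with n hn
  simp only [Pi.div_apply]
  rw [← mul_div_assoc, div_div_div_cancel_right₀ hn.ne']

theorem stmt14 (P₁ : Measure ℝ) [IsProbabilityMeasure P₁]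
    (hP₁ : P₁ = (2 : ℝ≥0∞)⁻¹ • P₁.map (fun x => x / 3) +
      (2 : ℝ≥0∞)⁻¹ • P₁.map (fun x => x / 3 + 1/3))
    (P : Measure ℝ) (hP : P = mix P₁ discD) :
    Tendsto (fun n : ℕ => 2 * Real.log n / (- Real.log (quantErr P n))) atTop
      (nhds (Real.log 2 / Real.log 3)) ∧
    Tendsto (fun n : ℕ => 2 * Real.log n / (- Real.log (quantErr P₁ n))) atTop
      (nhds (Real.log 2 / Real.log 3)) := by
  have hinv : IsCantorInvariant P₁ := hP₁
  subst hP
  exact ⟨tendsto_quantization_dimension hinv.hasCantorNets_mix hinv.isCantorSpread_mix,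
    tendsto_quantization_dimension hinv.hasCantorNets hinv.isCantorSpread⟩
end
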